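/- arXiv:1906.07819 — 3 statements merged into one kernel-verified Lean document; each statement's English description precedes it below -/
import Mathlib

section
/- Let θ : ℕ → ℝ ∪ {∞} satisfy θ(1) ≥ 2 and θ(n) ≥ P⁺(n) for all n ≥ 2, where P⁺(n) is the largest prime factor of n. Let χ be the characteristic function of the associated set 𝓑. Then for every complex number s with Re(s) > 1, the series Σ_{n ≥ 1} χ(n)·n^{−s}·∏_{p ≤ θ(n)} (1 − p^{−s}) converges with sum equal to 1, where p runs over primes. -/
open scoped BigOperators
open Classical

/-- Membership in the set `𝓑` associated to `θ`: `n = 1`, or `n ≥ 2` whose prime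
factorization `p₁^{α₁}···p_k^{α_k}` (with `p₁ < ⋯ < p_k`) satisfies
`p_{j+1} ≤ θ(p₁^{α₁}···p_j^{α_j})` for all `0 ≤ j < k`; equivalently, every prime `p`
dividing `n` satisfies `p ≤ θ(m)` where `m` is the part of `n` composed of primes `< p`. -/
def BMem (θ : ℕ → WithTop ℝ) (n : ℕ) : Prop :=
  0 < n ∧ ∀ p ∈ n.primeFactors,
    ((p : ℝ) : WithTop ℝ) ≤ θ (∏ q ∈ n.primeFactors.filter (fun q => q < p), q ^ n.factorization q)

/-- The part of `m` composed of the primes satisfying `P`. -/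
noncomputable def primePart (m : ℕ) (P : ℕ → Prop) [DecidablePred P] : ℕ :=
  ∏ q ∈ m.primeFactors.filter P, q ^ m.factorization q

lemma primePart_ne_zero (m : ℕ) (P : ℕ → Prop) [DecidablePred P] : primePart m P ≠ 0 :=
  Finset.prod_ne_zero_iff.2 fun _ hq =>
    pow_ne_zero _ (Nat.prime_of_mem_primeFactors (Finset.mem_filter.1 hq).1).ne_zero

lemma factorization_primePart (m : ℕ) (P : ℕ → Prop) [DecidablePred P] :
    (primePart m P).factorization = m.factorization.filter P := by
  have h : primePart m P = (m.factorization.filter P).prod (· ^ ·) := by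
    rw [primePart, Finsupp.prod, Finsupp.support_filter, Nat.support_factorization]
    refine Finset.prod_congr rfl fun q hq => ?_
    rw [Finsupp.filter_apply_pos _ _ (Finset.mem_filter.1 hq).2]
  rw [h]
  refine Nat.prod_pow_factorization_eq_self fun p hp => ?_
  rw [Finsupp.support_filter, Nat.support_factorization] at hp
  exact Nat.prime_of_mem_primeFactors (Finset.mem_filter.1 hp).1

lemma mem_primeFactors_primePart {m p : ℕ} {P : ℕ → Prop} [DecidablePred P] :
    p ∈ (primePart m P).primeFactors ↔ p ∈ m.primeFactors ∧ P p := by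
  rw [← Nat.support_factorization, factorization_primePart, Finsupp.support_filter,
    Finset.mem_filter, Nat.support_factorization]

lemma primePart_eq_primePart {m n : ℕ} {P Q : ℕ → Prop} [DecidablePred P] [DecidablePred Q]
    (h : ∀ q, q.Prime → (if P q then m.factorization q else 0) =
      if Q q then n.factorization q else 0) :
    primePart m P = primePart n Q := by
  refine Nat.eq_of_factorization_eq (primePart_ne_zero _ _) (primePart_ne_zero _ _) fun q => ?_
  by_cases hq : q.Prime
  · simpa [factorization_primePart, Finsupp.filter_apply] using h q hq
  · simp [Nat.factorization_eq_zero_of_not_prime _ hq]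

lemma primePart_dvd {m : ℕ} (hm : m ≠ 0) (P : ℕ → Prop) [DecidablePred P] :
    primePart m P ∣ m := by
  rw [← Nat.factorization_le_iff_dvd (primePart_ne_zero _ _) hm, factorization_primePart]
  intro q
  rw [Finsupp.filter_apply]
  split_ifs <;> simp

lemma primePart_eq_self {m : ℕ} (hm : m ≠ 0) {P : ℕ → Prop} [DecidablePred P]
    (h : ∀ q ∈ m.primeFactors, P q) : primePart m P = m := by
  rw [primePart, Finset.filter_true_of_mem h]
  exact Nat.prod_factorization_pow_eq_self hm

/-- `p ≤ θ n`, as a condition on the prime `p`. -/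
def IsSmooth (θ : ℕ → WithTop ℝ) (n p : ℕ) : Prop := ((p : ℝ) : WithTop ℝ) ≤ θ n

lemma IsSmooth.mono {θ : ℕ → WithTop ℝ} {n p q : ℕ} (hp : IsSmooth θ n p) (hq : q ≤ p) :
    IsSmooth θ n q :=
  le_trans (WithTop.coe_le_coe.2 (Nat.cast_le.2 hq)) hp

lemma bMem_iff {θ : ℕ → WithTop ℝ} {n : ℕ} :
    BMem θ n ↔ 0 < n ∧ ∀ p ∈ n.primeFactors, IsSmooth θ (primePart n (· < p)) p :=
  Iff.rfl

/-- The primes of `m` that violate the defining condition of `𝓑`. -/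
noncomputable def badPrimes (θ : ℕ → WithTop ℝ) (m : ℕ) : Finset ℕ :=
  m.primeFactors.filter fun p => ¬ IsSmooth θ (primePart m (· < p)) p

/-- The largest initial segment of the prime factorization of `m` that lies in `𝓑`. -/
noncomputable def bPart (θ : ℕ → WithTop ℝ) (m : ℕ) : ℕ :=
  primePart m fun q => ∀ p ∈ badPrimes θ m, q < p

lemma bMem_bPart (θ : ℕ → WithTop ℝ) (m : ℕ) : BMem θ (bPart θ m) := by
  refine bMem_iff.2 ⟨(primePart_ne_zero _ _).bot_lt, fun p hp => ?_⟩
  obtain ⟨hpm, hp⟩ := mem_primeFactors_primePart.1 hp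
  have hgood : IsSmooth θ (primePart m (· < p)) p := by
    by_contra h
    exact (hp p (Finset.mem_filter.2 ⟨hpm, h⟩)).false
  convert hgood using 1
  refine primePart_eq_primePart fun q _ => ?_
  split_ifs with hqp
  · rw [bPart, factorization_primePart,
      Finsupp.filter_apply_pos _ _ fun p' hp' => hqp.trans (hp p' hp')]
  · rfl

lemma not_isSmooth_bPart {θ : ℕ → WithTop ℝ} {m q : ℕ}
    (hq : (bPart θ m).factorization q ≠ m.factorization q) : ¬ IsSmooth θ (bPart θ m) q := by
  rw [bPart, factorization_primePart, Finsupp.filter_apply] at hq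
  have hex : ¬ ∀ p ∈ badPrimes θ m, q < p := fun h => hq (if_pos h)
  have hne : (badPrimes θ m).Nonempty := by
    by_contra h
    exact hex (by simp [Finset.not_nonempty_iff_eq_empty.1 h])
  set p₀ := (badPrimes θ m).min' hne with hp₀
  have hpart : bPart θ m = primePart m (· < p₀) := by
    refine primePart_eq_primePart fun r _ => ?_
    simp [hp₀, Finset.lt_min'_iff]
  have hp₀q : p₀ ≤ q := by
    rw [← not_lt, hp₀, Finset.lt_min'_iff]
    exact hex
  rw [hpart]
  exact fun h => (Finset.mem_filter.1 ((badPrimes θ m).min'_mem hne)).2 (h.mono hp₀q)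

lemma bPart_mul_eq {θ : ℕ → WithTop ℝ}
    (hθ : ∀ n : ℕ, ∀ p ∈ n.primeFactors, IsSmooth θ n p) {n r : ℕ} (hn : BMem θ n) (hr : r ≠ 0)
    (hrough : ∀ p ∈ r.primeFactors, ¬ IsSmooth θ n p) : bPart θ (n * r) = n := by
  have hn0 : n ≠ 0 := hn.1.ne'
  have hfac (q : ℕ) : (n * r).factorization q = n.factorization q + r.factorization q := by
    simp [Nat.factorization_mul hn0 hr]
  have hr0 {q : ℕ} (hq : IsSmooth θ n q) : r.factorization q = 0 :=
    Finsupp.notMem_support_iff.1 fun h => hrough q (by simpa using h) hq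
  have hpart {p : ℕ} (hp : ∀ q, q.Prime → q < p → r.factorization q = 0) :
      primePart (n * r) (· < p) = primePart n (· < p) :=
    primePart_eq_primePart fun q hq => by
      split_ifs with h
      · rw [hfac, hp q hq h, add_zero]
      · rfl
  have hbad : ∀ p ∈ badPrimes θ (n * r), p ∈ r.primeFactors := by
    intro p hp
    obtain ⟨hp, hps⟩ := Finset.mem_filter.1 hp
    rw [Nat.primeFactors_mul hn0 hr, Finset.mem_union] at hp
    refine hp.resolve_left fun hpn => hps ?_
    rw [hpart fun q _ hq => hr0 ((hθ n p hpn).mono hq.le)]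
    exact (bMem_iff.1 hn).2 p hpn
  refine Nat.eq_of_factorization_eq (primePart_ne_zero _ _) hn0 fun q => ?_
  rw [bPart, factorization_primePart, Finsupp.filter_apply]
  by_cases hqn : q ∈ n.primeFactors
  · have hq := hθ n q hqn
    rw [if_pos, hfac, hr0 hq, add_zero]
    intro p hp
    by_contra! h
    exact hrough p (hbad p hp) (hq.mono h)
  have hqn0 : n.factorization q = 0 := Finsupp.notMem_support_iff.1 (by simpa using hqn)
  rw [hqn0]
  by_cases hqr : q ∈ r.primeFactors
  · have hr1 : r ≠ 1 := by rintro rfl; simp at hqr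
    have hp₀ := Nat.minFac_prime hr1
    have hp₀r : r.minFac ∈ r.primeFactors := Nat.mem_primeFactors.2 ⟨hp₀, r.minFac_dvd, hr⟩
    have hpn : primePart (n * r) (· < r.minFac) = n := by
      rw [hpart fun q hq hlt => Nat.factorization_eq_zero_of_not_dvd fun h =>
        (Nat.minFac_le_of_dvd hq.two_le h).not_gt hlt]
      refine primePart_eq_self hn0 fun q hq => ?_
      by_contra! h
      exact hrough _ hp₀r ((hθ n q hq).mono h)
    rw [if_neg]
    intro h
    refine (h r.minFac (Finset.mem_filter.2 ⟨?_, ?_⟩)).not_ge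
      (Nat.minFac_le_of_dvd (Nat.prime_of_mem_primeFactors hqr).two_le
        (Nat.dvd_of_mem_primeFactors hqr))
    · rw [Nat.primeFactors_mul hn0 hr]
      exact Finset.mem_union_right _ hp₀r
    · rw [hpn]
      exact hrough _ hp₀r
  · have : r.factorization q = 0 := Finsupp.notMem_support_iff.1 (by simpa using hqr)
    rw [hfac, hqn0, this]
    simp

lemma bPart_mul_eq_iff {θ : ℕ → WithTop ℝ}
    (hθ : ∀ n : ℕ, ∀ p ∈ n.primeFactors, IsSmooth θ n p) {n r : ℕ} (hn : BMem θ n) (hr : r ≠ 0) :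
    bPart θ (n * r) = n ↔ ∀ p ∈ r.primeFactors, ¬ IsSmooth θ n p := by
  refine ⟨fun h p hp => ?_, bPart_mul_eq hθ hn hr⟩
  have hpr := (Nat.prime_of_mem_primeFactors hp).factorization_pos_of_dvd hr
    (Nat.dvd_of_mem_primeFactors hp)
  have := not_isSmooth_bPart (θ := θ) (m := n * r) (q := p) (by
    rw [h, Nat.factorization_mul hn.1.ne' hr, Finsupp.add_apply]
    omega)
  rwa [h] at this

/-- The restriction of a completely multiplicative function to the integers free of prime factors
satisfying `P`. -/
noncomputable def roughHom (f : ℕ →*₀ ℂ) (P : ℕ → Prop) : ℕ →*₀ ℂ where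
  toFun r := if ∀ p ∈ r.primeFactors, ¬ P p then f r else 0
  map_zero' := by simp
  map_one' := by simp
  map_mul' m n := by
    rcases eq_or_ne m 0 with rfl | hm
    · simp
    rcases eq_or_ne n 0 with rfl | hn
    · simp
    simp only [Nat.primeFactors_mul hm hn, Finset.forall_mem_union, map_mul]
    split_ifs <;> simp_all

lemma tsum_roughHom {f : ℕ →*₀ ℂ} (hf : Summable fun n => ‖f n‖) (P : ℕ → Prop) :
    ∑' r, roughHom f P r = (∑' r, f r) * ∏' p : ℕ, if p.Prime ∧ P p then 1 - f p else 1 := by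
  have hrough : Summable fun n => ‖roughHom f P n‖ := by
    refine hf.of_nonneg_of_le (fun _ => norm_nonneg _) fun n => ?_
    change ‖ite _ _ _‖ ≤ _
    split_ifs <;> simp
  have hmul : Multipliable fun p : ℕ => if p.Prime ∧ P p then 1 - f p else 1 := by
    have : Summable fun p : ℕ => ‖if p.Prime ∧ P p then -f p else 0‖ := by
      refine hf.of_nonneg_of_le (fun _ => norm_nonneg _) fun n => ?_
      split_ifs <;> simp
    refine (multipliable_one_add_of_summable this).congr fun p => ?_
    split_ifs <;> simp [sub_eq_add_neg]
  have hprod := hmul.hasProd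
  rw [← hasProd_subtype_iff_of_mulSupport_subset (s := {p : ℕ | p.Prime})] at hprod
  · refine (EulerProduct.eulerProduct_completely_multiplicative_hasProd hrough).unique ?_
    refine ((EulerProduct.eulerProduct_completely_multiplicative_hasProd hf).mul hprod).congr_fun fun p => ?_
    have hlt : ‖f p‖ < 1 := hf.of_norm.norm_lt_one (f := f.toMonoidHom) p.2.one_lt
    have hp : 1 - f p ≠ 0 := by
      intro h
      simp [← sub_eq_zero.1 h] at hlt
    have hrp : roughHom f P p = if P p then 0 else f p := by
      change ite _ _ _ = _
      simp [p.2.primeFactors]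
    change _ = (1 - f p)⁻¹ * if (p : ℕ).Prime ∧ P p then 1 - f p else 1
    simp only [hrp, p.2, true_and]
    split_ifs <;> simp [hp]
  · intro p hp
    by_contra h
    exact hp (if_neg fun h' => h h'.1)

theorem lemma1_complex (θ : ℕ → WithTop ℝ)
    (hθ1 : (2 : WithTop ℝ) ≤ θ 1)
    (hθ2 : ∀ n : ℕ, 2 ≤ n → ∀ p ∈ n.primeFactors, ((p : ℝ) : WithTop ℝ) ≤ θ n)
    (s : ℂ) (hs : 1 < s.re) :
    HasSum (fun n : ℕ =>
      if BMem θ n then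
        (n : ℂ) ^ (-s) *
          ∏' p : ℕ, (if p.Prime ∧ ((p : ℝ) : WithTop ℝ) ≤ θ n then 1 - (p : ℂ) ^ (-s) else 1)
      else 0) 1 := by
  have hθ : ∀ n : ℕ, ∀ p ∈ n.primeFactors, IsSmooth θ n p := by
    intro n p hp
    refine hθ2 n ?_ p hp
    exact (Nat.prime_of_mem_primeFactors hp).two_le.trans (Nat.le_of_mem_primeFactors hp)
  have hs0 := Complex.ne_zero_of_one_lt_re hs
  set f := riemannZetaSummandHom hs0
  have hfs : Summable fun n => ‖f n‖ := summable_riemannZetaSummand hs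
  have hζ : ∑' n, f n = riemannZeta s := tsum_riemannZetaSummand hs
  have hfib := ((hζ ▸ hfs.of_norm.hasSum).tsum_fiberwise (bPart θ)).mul_left (riemannZeta s)⁻¹
  rw [inv_mul_cancel₀ (riemannZeta_ne_zero_of_one_lt_re hs)] at hfib
  refine hfib.congr_fun fun n => ?_
  rw [tsum_subtype]
  split_ifs with hn
  · have hinj : Function.Injective (n * ·) := mul_right_injective₀ hn.1.ne'
    rw [← hinj.tsum_eq]
    · have : ∀ r, (bPart θ ⁻¹' {n}).indicator f (n * r) = f n * roughHom f (IsSmooth θ n) r := by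
        intro r
        rcases eq_or_ne r 0 with rfl | hr
        · simp [Set.indicator]
        simp only [Set.indicator, Set.mem_preimage, Set.mem_singleton_iff,
          bPart_mul_eq_iff hθ hn hr]
        change _ = f n * ite _ _ _
        split_ifs <;> simp
      simp_rw [this]
      rw [tsum_mul_left, tsum_roughHom hfs, hζ, mul_left_comm, inv_mul_cancel_left₀
        (riemannZeta_ne_zero_of_one_lt_re hs)]
      congr! 1
      refine tprod_congr fun p => ?_
      congr 1
    · intro m hm
      have hmn : bPart θ m = n := Set.mem_of_indicator_ne_zero (s := bPart θ ⁻¹' {n}) hm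
      have hm0 : m ≠ 0 := by
        rintro rfl
        simp at hm
      obtain ⟨r, hr⟩ : n ∣ m := hmn ▸ primePart_dvd hm0 _
      exact ⟨r, hr.symm⟩
  · rw [Set.preimage_singleton_eq_empty.2]
    · simp
    · rintro ⟨m, rfl⟩
      exact hn (bMem_bPart θ m)
end

section
/- Let θ : ℕ → ℝ ∪ {∞} satisfy θ(1) ≥ 2 and θ(n) ≥ P⁺(n) for all n ≥ 2, where P⁺(n) is the largest prime factor of n, and let χ be the characteristic function of the associated set 𝓑. Let q be a prime and h a positive integer. Then for every complex number s with Re(s) > 1: Σ_{n ≥ 1, q^h ∥ n} χ(n)·n^{−s}·∏_{p ≤ θ(n)} (1 − p^{−s}) = ((1 − q^{−s})/q^{sh}) · Σ_{n ≥ 1, θ(n) ≥ q} χ(n)·n^{−s}·∏_{p ≤ θ(n)} (1 − p^{−s}), where q^h ∥ n means q^h divides n but q^{h+1} does not, and p runs over primes. -/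
open scoped BigOperators
open Classical

/-- The largest divisor of `n` composed of primes less than `p`. -/
def primePartBelow (n p : ℕ) : ℕ :=
  ∏ q ∈ n.primeFactors.filter (fun q => q < p), q ^ n.factorization q

/-- Every prime factor of the nonzero number `r` fails to be bounded by `t`. -/
def IsRough (t : WithTop ℝ) (r : ℕ) : Prop :=
  r ≠ 0 ∧ ∀ p ∈ r.primeFactors, ¬ ((p : ℝ) : WithTop ℝ) ≤ t

lemma coe_natCast_le_coe_natCast {a b : ℕ} (h : a ≤ b) :
    ((a : ℝ) : WithTop ℝ) ≤ ((b : ℝ) : WithTop ℝ) := by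
  exact_mod_cast h

lemma primePartBelow_eq_prod_range (n p : ℕ) :
    primePartBelow n p = ∏ q ∈ Finset.range p, q ^ n.factorization q := by
  refine Finset.prod_subset (fun q hq => ?_) (fun q hq hq' => ?_)
  · simp only [Finset.mem_filter] at hq
    exact Finset.mem_range.2 hq.2
  · have : q ∉ n.primeFactors := fun h =>
      hq' (Finset.mem_filter.2 ⟨h, Finset.mem_range.1 hq⟩)
    rw [← Nat.support_factorization, Finsupp.notMem_support_iff] at this
    simp [this]

lemma primePartBelow_mul {m n : ℕ} (hm : m ≠ 0) (hn : n ≠ 0) (p : ℕ) :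
    primePartBelow (m * n) p = primePartBelow m p * primePartBelow n p := by
  simp only [primePartBelow_eq_prod_range, Nat.factorization_mul hm hn, Finsupp.add_apply,
    pow_add, Finset.prod_mul_distrib]

lemma primePartBelow_eq_one {n p : ℕ} (h : ∀ q ∈ n.primeFactors, p ≤ q) :
    primePartBelow n p = 1 := by
  rw [primePartBelow, Finset.filter_false_of_mem, Finset.prod_empty]
  exact fun q hq => not_lt.2 (h q hq)

lemma primePartBelow_eq_self {n p : ℕ} (hn : n ≠ 0) (h : ∀ q ∈ n.primeFactors, q < p) :
    primePartBelow n p = n := by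
  rw [primePartBelow, Finset.filter_true_of_mem h]
  exact Nat.prod_factorization_pow_eq_self hn

lemma primePartBelow_ne_zero (n p : ℕ) : primePartBelow n p ≠ 0 := by
  refine Finset.prod_ne_zero_iff.2 fun q hq => pow_ne_zero _ ?_
  exact (Nat.prime_of_mem_primeFactors (Finset.mem_filter.1 hq).1).ne_zero

lemma mem_primeFactors_of_mem_primeFactors_primePartBelow {n p q : ℕ}
    (h : q ∈ (primePartBelow n p).primeFactors) : q ∈ n.primeFactors ∧ q < p := by
  have hq := Nat.prime_of_mem_primeFactors h
  obtain ⟨a, ha, hqa⟩ := (hq.prime.dvd_finsetProd_iff _).1 (Nat.dvd_of_mem_primeFactors h)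
  rw [Finset.mem_filter] at ha
  rw [(Nat.prime_dvd_prime_iff_eq hq (Nat.prime_of_mem_primeFactors ha.1)).1
    (hq.dvd_of_dvd_pow hqa)]
  exact ha

lemma exists_eq_primePartBelow_mul {n : ℕ} (hn : n ≠ 0) (p : ℕ) :
    ∃ r, r ≠ 0 ∧ n = primePartBelow n p * r ∧ ∀ q ∈ r.primeFactors, q ∈ n.primeFactors ∧ p ≤ q := by
  refine ⟨∏ q ∈ n.primeFactors.filter (fun q => ¬ q < p), q ^ n.factorization q, ?_, ?_, ?_⟩
  · refine Finset.prod_ne_zero_iff.2 fun q hq => pow_ne_zero _ ?_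
    exact (Nat.prime_of_mem_primeFactors (Finset.mem_filter.1 hq).1).ne_zero
  · rw [primePartBelow, Finset.prod_filter_mul_prod_filter_not]
    exact (Nat.prod_factorization_pow_eq_self hn).symm
  · intro q h
    have hq := Nat.prime_of_mem_primeFactors h
    obtain ⟨a, ha, hqa⟩ := (hq.prime.dvd_finsetProd_iff _).1 (Nat.dvd_of_mem_primeFactors h)
    rw [Finset.mem_filter, not_lt] at ha
    rw [(Nat.prime_dvd_prime_iff_eq hq (Nat.prime_of_mem_primeFactors ha.1)).1
      (hq.dvd_of_dvd_pow hqa)]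
    exact ha

lemma primePartBelow_mul_of_le {n r p : ℕ} (hn : n ≠ 0) (hr : r ≠ 0)
    (h : ∀ q ∈ r.primeFactors, p ≤ q) : primePartBelow (n * r) p = primePartBelow n p := by
  rw [primePartBelow_mul hn hr, primePartBelow_eq_one h, mul_one]

lemma primePartBelow_primePartBelow {n p q : ℕ} (hn : n ≠ 0) (h : q ≤ p) :
    primePartBelow (primePartBelow n p) q = primePartBelow n q := by
  obtain ⟨r, hr, hnr, hrp⟩ := exists_eq_primePartBelow_mul hn p
  conv_rhs => rw [hnr]
  rw [primePartBelow_mul_of_le (primePartBelow_ne_zero _ _) hr]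
  exact fun a ha => h.trans (hrp a ha).2

/-- The decomposition of a nonzero number into a member of `𝓑` and a rough cofactor. -/
lemma exists_BMem_mul_isRough (θ : ℕ → WithTop ℝ) {m : ℕ} (hm : m ≠ 0) :
    ∃ n r, BMem θ n ∧ IsRough (θ n) r ∧ n * r = m := by
  by_cases hS : ∃ p, p ∈ m.primeFactors ∧ ¬ ((p : ℝ) : WithTop ℝ) ≤ θ (primePartBelow m p)
  · obtain ⟨hp, hpθ⟩ := Nat.find_spec hS
    set p := Nat.find hS with hp_def
    obtain ⟨r, hr, hmr, hrp⟩ := exists_eq_primePartBelow_mul hm p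
    refine ⟨primePartBelow m p, r, ⟨Nat.pos_of_ne_zero (primePartBelow_ne_zero _ _), ?_⟩,
      ⟨hr, ?_⟩, hmr.symm⟩
    · intro a ha
      obtain ⟨ham, hap⟩ := mem_primeFactors_of_mem_primeFactors_primePartBelow ha
      have := Nat.find_min hS hap
      rw [not_and, not_not] at this
      change _ ≤ θ (primePartBelow (primePartBelow m p) a)
      rw [primePartBelow_primePartBelow hm hap.le]
      exact this ham
    · intro a ha h
      exact hpθ ((coe_natCast_le_coe_natCast (hrp a ha).2).trans h)
  · push Not at hS
    exact ⟨m, 1, ⟨Nat.pos_of_ne_zero hm, hS⟩, ⟨one_ne_zero, by simp⟩, mul_one m⟩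

section

variable {θ : ℕ → WithTop ℝ}

lemma BMem.ne_zero {n : ℕ} (hn : BMem θ n) : n ≠ 0 := hn.1.ne'

lemma le_theta_of_mem_primeFactors
    (hθ : ∀ n : ℕ, 2 ≤ n → ∀ p ∈ n.primeFactors, ((p : ℝ) : WithTop ℝ) ≤ θ n)
    {n p : ℕ} (hp : p ∈ n.primeFactors) : ((p : ℝ) : WithTop ℝ) ≤ θ n := by
  refine hθ n ?_ p hp
  exact (Nat.prime_of_mem_primeFactors hp).two_le.trans (Nat.le_of_mem_primeFactors hp)

lemma IsRough.lt_of_le {t : WithTop ℝ} {r a p : ℕ} (hr : IsRough t r) (hp : p ∈ r.primeFactors)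
    (ha : ((a : ℝ) : WithTop ℝ) ≤ t) : a < p := by
  by_contra! h
  exact hr.2 p hp ((coe_natCast_le_coe_natCast h).trans ha)

lemma primePartBelow_mul_of_le_theta {n r a : ℕ} (hn : BMem θ n) (hr : IsRough (θ n) r)
    (ha : ((a : ℝ) : WithTop ℝ) ≤ θ n) : primePartBelow (n * r) a = primePartBelow n a :=
  primePartBelow_mul_of_le hn.ne_zero hr.1 fun _ hp => (hr.lt_of_le hp ha).le

lemma primePartBelow_mul_minFac
    (hθ : ∀ n : ℕ, 2 ≤ n → ∀ p ∈ n.primeFactors, ((p : ℝ) : WithTop ℝ) ≤ θ n)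
    {n r : ℕ} (hn : BMem θ n) (hr : IsRough (θ n) r) (hr1 : r ≠ 1) :
    primePartBelow (n * r) r.minFac = n := by
  rw [primePartBelow_mul_of_le hn.ne_zero hr.1
    fun p hp => Nat.minFac_le_of_dvd (Nat.prime_of_mem_primeFactors hp).two_le
      (Nat.dvd_of_mem_primeFactors hp)]
  refine primePartBelow_eq_self hn.ne_zero fun p hp =>
    hr.lt_of_le ?_ (le_theta_of_mem_primeFactors hθ hp)
  exact Nat.mem_primeFactors.2 ⟨Nat.minFac_prime hr1, Nat.minFac_dvd r, hr.1⟩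

lemma dvd_of_BMem_mul_isRough_eq
    (hθ : ∀ n : ℕ, 2 ≤ n → ∀ p ∈ n.primeFactors, ((p : ℝ) : WithTop ℝ) ≤ θ n)
    {n r n' r' : ℕ} (hn : BMem θ n) (hr : IsRough (θ n) r) (hn' : BMem θ n')
    (hr' : IsRough (θ n') r') (h : n * r = n' * r') : n ∣ n' := by
  refine Nat.Coprime.dvd_of_dvd_mul_right (k := n) (n := r') ?_ (Dvd.intro r h)
  refine Nat.Coprime.symm (Nat.coprime_of_dvd fun p hp hpr' hpn => ?_)
  have hr1 : r' ≠ 1 := by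
    rintro rfl
    exact hp.one_lt.ne' (Nat.dvd_one.1 hpr')
  have hprime := Nat.minFac_prime hr1
  have hle : r'.minFac ≤ p := Nat.minFac_le_of_dvd hp.two_le hpr'
  have hpθ := le_theta_of_mem_primeFactors hθ (Nat.mem_primeFactors.2 ⟨hp, hpn, hn.ne_zero⟩)
  have hmθ := (coe_natCast_le_coe_natCast hle).trans hpθ
  have hlow := primePartBelow_mul_minFac hθ hn' hr' hr1
  have hdvd : r'.minFac ∣ n * r := h ▸ (Nat.minFac_dvd r').mul_left n'
  refine hr'.2 r'.minFac (Nat.mem_primeFactors.2 ⟨hprime, Nat.minFac_dvd r', hr'.1⟩) ?_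
  rw [← h, primePartBelow_mul_of_le_theta hn hr hmθ] at hlow
  rcases hprime.dvd_mul.1 hdvd with hd | hd
  · have := hn.2 _ (Nat.mem_primeFactors.2 ⟨hprime, hd, hn.ne_zero⟩)
    change _ ≤ θ (primePartBelow n r'.minFac) at this
    rwa [hlow] at this
  · exact absurd (hr.lt_of_le (Nat.mem_primeFactors.2 ⟨hprime, hd, hr.1⟩) hmθ) (lt_irrefl _)

lemma eq_of_BMem_mul_isRough_eq
    (hθ : ∀ n : ℕ, 2 ≤ n → ∀ p ∈ n.primeFactors, ((p : ℝ) : WithTop ℝ) ≤ θ n)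
    {n r n' r' : ℕ} (hn : BMem θ n) (hr : IsRough (θ n) r) (hn' : BMem θ n')
    (hr' : IsRough (θ n') r') (h : n * r = n' * r') : n = n' ∧ r = r' := by
  have hnn : n = n' := Nat.dvd_antisymm (dvd_of_BMem_mul_isRough_eq hθ hn hr hn' hr' h)
    (dvd_of_BMem_mul_isRough_eq hθ hn' hr' hn hr h.symm)
  subst hnn
  exact ⟨rfl, Nat.eq_of_mul_eq_mul_left hn.1 h⟩

/-- The prime factors of `m` below `q`, and `q` itself, satisfy the bounds defining `𝓑`. -/
def Admissible (θ : ℕ → WithTop ℝ) (q m : ℕ) : Prop :=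
  (∀ p ∈ m.primeFactors, p < q → ((p : ℝ) : WithTop ℝ) ≤ θ (primePartBelow m p)) ∧
    ((q : ℝ) : WithTop ℝ) ≤ θ (primePartBelow m q)

lemma le_theta_iff_admissible
    (hθ : ∀ n : ℕ, 2 ≤ n → ∀ p ∈ n.primeFactors, ((p : ℝ) : WithTop ℝ) ≤ θ n)
    {n r : ℕ} (hn : BMem θ n) (hr : IsRough (θ n) r) (q : ℕ) :
    ((q : ℝ) : WithTop ℝ) ≤ θ n ↔ Admissible θ q (n * r) := by
  constructor
  · intro hq
    refine ⟨fun p hp hpq => ?_, ?_⟩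
    · have hpθ := (coe_natCast_le_coe_natCast hpq.le).trans hq
      rw [primePartBelow_mul_of_le_theta hn hr hpθ]
      rw [Nat.primeFactors_mul hn.ne_zero hr.1, Finset.mem_union] at hp
      rcases hp with hp | hp
      · exact hn.2 p hp
      · exact absurd hpθ (hr.2 p hp)
    · rw [primePartBelow_mul_of_le_theta hn hr hq]
      by_cases hS : ∃ p, p ∈ n.primeFactors ∧ q ≤ p
      · obtain ⟨hp, hqp⟩ := Nat.find_spec hS
        have := hn.2 _ hp
        change _ ≤ θ (primePartBelow n _) at this
        have hfilter : primePartBelow n (Nat.find hS) = primePartBelow n q := by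
          rw [primePartBelow, primePartBelow]
          congr 1
          refine Finset.filter_congr fun a ha => ⟨fun h => ?_, fun h => h.trans_le hqp⟩
          have := Nat.find_min hS h
          rw [not_and, not_le] at this
          exact this ha
        rw [hfilter] at this
        exact (coe_natCast_le_coe_natCast hqp).trans this
      · push Not at hS
        rwa [primePartBelow_eq_self hn.ne_zero hS]
  · rintro ⟨h1, h2⟩
    have hrq : ∀ p ∈ r.primeFactors, q ≤ p := by
      intro p hp
      by_contra! hpq
      have hr1 : r ≠ 1 := by
        rintro rfl
        simp at hp
      have hmem : r.minFac ∈ r.primeFactors :=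
        Nat.mem_primeFactors.2 ⟨Nat.minFac_prime hr1, Nat.minFac_dvd r, hr.1⟩
      have hle : r.minFac ≤ p := Nat.minFac_le_of_dvd (Nat.prime_of_mem_primeFactors hp).two_le
        (Nat.dvd_of_mem_primeFactors hp)
      have := h1 r.minFac (by
        rw [Nat.primeFactors_mul hn.ne_zero hr.1]
        exact Finset.mem_union_right _ hmem) (hle.trans_lt hpq)
      rw [primePartBelow_mul_minFac hθ hn hr hr1] at this
      exact hr.2 _ hmem this
    rw [primePartBelow_mul_of_le hn.ne_zero hr.1 hrq] at h2
    by_cases hS : ∀ p ∈ n.primeFactors, p < q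
    · rwa [primePartBelow_eq_self hn.ne_zero hS] at h2
    · push Not at hS
      obtain ⟨p, hp, hqp⟩ := hS
      exact (coe_natCast_le_coe_natCast hqp).trans (le_theta_of_mem_primeFactors hθ hp)

lemma admissible_pow_mul {q : ℕ} (hq : q.Prime) (k : ℕ) {m : ℕ} (hm : m ≠ 0) :
    Admissible θ q (q ^ k * m) ↔ Admissible θ q m := by
  have hk : q ^ k ≠ 0 := pow_ne_zero _ hq.ne_zero
  have hfac : ∀ a ∈ (q ^ k).primeFactors, a = q := fun a ha =>
    (Nat.prime_dvd_prime_iff_eq (Nat.prime_of_mem_primeFactors ha) hq).1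
      ((Nat.prime_of_mem_primeFactors ha).dvd_of_dvd_pow (Nat.dvd_of_mem_primeFactors ha))
  have hlow : ∀ p, p ≤ q → primePartBelow (q ^ k * m) p = primePartBelow m p := by
    intro p hp
    rw [mul_comm]
    exact primePartBelow_mul_of_le hm hk fun a ha => hp.trans_eq (hfac a ha).symm
  rw [Admissible, Admissible, hlow q le_rfl, Nat.primeFactors_mul hk hm]
  refine and_congr_left fun _ => ⟨fun h p hp hpq => ?_, fun h p hp hpq => ?_⟩
  · rw [← hlow p hpq.le]
    exact h p (Finset.mem_union_right _ hp) hpq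
  · rw [hlow p hpq.le]
    rcases Finset.mem_union.1 hp with hp | hp
    · exact absurd (hfac p hp) hpq.ne
    · exact h p hp hpq

lemma pow_dvd_iff_pow_dvd_mul_of_isRough {n r q : ℕ} (hr : IsRough (θ n) r) (hq : q.Prime)
    (hqn : ((q : ℝ) : WithTop ℝ) ≤ θ n) (k : ℕ) : q ^ k ∣ n ↔ q ^ k ∣ n * r := by
  have hqr : ¬ q ∣ r := fun h => hr.2 q (Nat.mem_primeFactors.2 ⟨hq, h, hr.1⟩) hqn
  exact (((hq.coprime_iff_not_dvd.2 hqr).pow_left k).dvd_mul_right).symm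

lemma exactly_dvd_iff_admissible
    (hθ : ∀ n : ℕ, 2 ≤ n → ∀ p ∈ n.primeFactors, ((p : ℝ) : WithTop ℝ) ≤ θ n)
    {n r : ℕ} (hn : BMem θ n) (hr : IsRough (θ n) r) {q : ℕ} (hq : q.Prime) {h : ℕ} (hh : 0 < h) :
    (q ^ h ∣ n ∧ ¬ q ^ (h + 1) ∣ n) ↔
      (q ^ h ∣ n * r ∧ ¬ q ^ (h + 1) ∣ n * r) ∧ Admissible θ q (n * r) := by
  rw [← le_theta_iff_admissible hθ hn hr]
  by_cases hqn : ((q : ℝ) : WithTop ℝ) ≤ θ n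
  · rw [pow_dvd_iff_pow_dvd_mul_of_isRough hr hq hqn h,
      pow_dvd_iff_pow_dvd_mul_of_isRough hr hq hqn (h + 1)]
    exact (and_iff_left hqn).symm
  · refine iff_of_false (fun H => hqn ?_) (fun H => hqn H.2)
    exact le_theta_of_mem_primeFactors hθ
      (Nat.mem_primeFactors.2 ⟨hq, (dvd_pow_self q hh.ne').trans H.1, hn.ne_zero⟩)

end

section

variable {f : ℕ →*₀ ℂ}

/-- The restriction of `f` to the numbers that are rough with respect to `t`. -/
noncomputable def roughRestrict (f : ℕ →*₀ ℂ) (t : WithTop ℝ) : ℕ →*₀ ℂ where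
  toFun r := if IsRough t r then f r else 0
  map_zero' := by simp
  map_one' := by
    rw [if_pos ⟨one_ne_zero, by simp⟩, map_one]
  map_mul' a b := by
    have h : IsRough t (a * b) ↔ IsRough t a ∧ IsRough t b := by
      by_cases ha : a = 0
      · simp [IsRough, ha]
      by_cases hb : b = 0
      · simp [IsRough, hb]
      simp only [IsRough, Nat.primeFactors_mul ha hb, Finset.mem_union]
      have := mul_ne_zero ha hb
      grind
    by_cases ha : IsRough t a <;> by_cases hb : IsRough t b <;> simp [h, ha, hb]

lemma roughRestrict_apply (f : ℕ →*₀ ℂ) (t : WithTop ℝ) (r : ℕ) :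
    roughRestrict f t r = if IsRough t r then f r else 0 := rfl

lemma norm_ite_le_norm (P : Prop) [Decidable P] (z : ℂ) : ‖if P then z else 0‖ ≤ ‖z‖ := by
  split_ifs <;> simp

lemma one_sub_ne_zero_of_summable (hf : Summable (‖f ·‖)) (p : Nat.Primes) : 1 - f p ≠ 0 := by
  intro h
  have h1 : f p = 1 := (sub_eq_zero.1 h).symm
  have hinj : Function.Injective fun k : ℕ => (p : ℕ) ^ k := Nat.pow_right_injective p.2.two_le
  have := (hf.comp_injective hinj).tendsto_atTop_zero
  simp [Function.comp_def, h1] at this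

/-- The Euler product over the primes bounded by `t` is a quotient of two Dirichlet series. -/
lemma tprod_le_eq_tsum_isRough_div (hf : Summable (‖f ·‖)) (hf0 : ∑' n, f n ≠ 0)
    (t : WithTop ℝ) :
    ∏' p : ℕ, (if p.Prime ∧ ((p : ℝ) : WithTop ℝ) ≤ t then 1 - f p else 1) =
      (∑' r, if IsRough t r then f r else 0) / ∑' n, f n := by
  have hg : Summable (‖roughRestrict f t ·‖) :=
    hf.of_nonneg_of_le (fun _ => norm_nonneg _) fun r => norm_ite_le_norm _ _
  have key := (EulerProduct.eulerProduct_completely_multiplicative_hasProd hg).div₀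
    (EulerProduct.eulerProduct_completely_multiplicative_hasProd hf) hf0
  have hinj : Function.Injective ((↑) : Nat.Primes → ℕ) := Subtype.val_injective
  rw [← hinj.tprod_eq (f := fun p : ℕ =>
    if p.Prime ∧ ((p : ℝ) : WithTop ℝ) ≤ t then 1 - f p else 1)]
  · suffices HasProd (fun p : Nat.Primes =>
        if (p : ℕ).Prime ∧ (((p : ℕ) : ℝ) : WithTop ℝ) ≤ t then 1 - f p else 1)
        ((∑' r, roughRestrict f t r) / ∑' n, f n) from this.tprod_eq
    convert! key using 1
    ext p
    have hp := one_sub_ne_zero_of_summable hf p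
    have hrough : IsRough t p ↔ ¬ (((p : ℕ) : ℝ) : WithTop ℝ) ≤ t := by
      simp [IsRough, p.2.primeFactors, p.2.ne_zero]
    by_cases h : (((p : ℕ) : ℝ) : WithTop ℝ) ≤ t
    · rw [if_pos ⟨p.2, h⟩, roughRestrict_apply, if_neg fun H => hrough.1 H h]
      simp
    · rw [if_neg fun H => h H.2, roughRestrict_apply, if_pos (hrough.2 h)]
      exact (div_self (inv_ne_zero hp)).symm
  · intro p hp
    rw [Function.mem_mulSupport] at hp
    by_contra hp'
    refine hp (if_neg fun H => hp' ⟨⟨p, H.1⟩, rfl⟩)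

lemma tsum_BMem_mul_tsum_isRough {θ : ℕ → WithTop ℝ}
    (hθ : ∀ n : ℕ, 2 ≤ n → ∀ p ∈ n.primeFactors, ((p : ℝ) : WithTop ℝ) ≤ θ n)
    (hf : Summable (‖f ·‖)) {C D : ℕ → Prop}
    [DecidablePred C] [DecidablePred D]
    (hCD : ∀ n r, BMem θ n → IsRough (θ n) r → (C n ↔ D (n * r))) :
    ∑' n, (if BMem θ n ∧ C n then f n * ∑' r, (if IsRough (θ n) r then f r else 0) else 0) =
      ∑' m, if D m then f m else 0 := by
  let F : ℕ × ℕ → ℂ := fun x =>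
    if (BMem θ x.1 ∧ C x.1) ∧ IsRough (θ x.1) x.2 then f x.1 * f x.2 else 0
  have hF : Summable F := by
    refine Summable.of_norm_bounded (hf.mul_norm hf) fun x => norm_ite_le_norm _ _
  calc
    _ = ∑' n, ∑' r, F (n, r) := by
      refine tsum_congr fun n => ?_
      by_cases h : BMem θ n ∧ C n
      · simp only [F, h, if_true, true_and, ← tsum_mul_left, mul_ite, mul_zero]
      · simp only [F, h, if_false, false_and, tsum_zero]
    _ = ∑' x, F x := hF.tsum_prod.symm
    _ = _ := by
      have hmem : ∀ x : Function.support F,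
          (BMem θ x.1.1 ∧ C x.1.1) ∧ IsRough (θ x.1.1) x.1.2 := by
        intro x
        by_contra h
        exact x.2 (if_neg h)
      refine (tsum_eq_tsum_of_ne_zero_bij (fun x => x.1.1 * x.1.2) ?_ ?_ ?_).symm
      · intro x y hxy
        obtain ⟨h1, h2⟩ := eq_of_BMem_mul_isRough_eq hθ (hmem x).1.1 (hmem x).2 (hmem y).1.1
          (hmem y).2 hxy
        exact Subtype.ext (Prod.ext h1 h2)
      · intro m hm
        rw [Function.mem_support] at hm
        have hD : D m := by
          by_contra h
          exact hm (if_neg h)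
        rw [if_pos hD] at hm
        have hm0 : m ≠ 0 := by
          rintro rfl
          exact hm (map_zero f)
        obtain ⟨n, r, hn, hr, rfl⟩ := exists_BMem_mul_isRough θ hm0
        refine ⟨⟨(n, r), ?_⟩, rfl⟩
        have : F (n, r) = f n * f r := if_pos ⟨⟨hn, (hCD n r hn hr).2 hD⟩, hr⟩
        rwa [Function.mem_support, this, ← map_mul]
      · intro x
        have h := hmem x
        rw [if_pos ((hCD _ _ h.1.1 h.2).1 h.1.2), map_mul]
        exact (if_pos h).symm

lemma tsum_dvd_eq_tsum_mul {a : ℕ} (ha : a ≠ 0) (G : ℕ → ℂ) :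
    ∑' m, (if a ∣ m then G m else 0) = ∑' m, G (a * m) := by
  have hinj : Function.Injective fun m : ℕ => a * m := mul_right_injective₀ ha
  rw [← hinj.tsum_eq]
  · simp
  · intro m hm
    rw [Function.mem_support] at hm
    have h : a ∣ m := by
      by_contra h
      exact hm (if_neg h)
    obtain ⟨b, rfl⟩ := h
    exact ⟨b, rfl⟩

lemma tsum_exactly_dvd_admissible (θ : ℕ → WithTop ℝ) (hf : Summable (‖f ·‖)) {q : ℕ}
    (hq : q.Prime) (h : ℕ) :
    ∑' m, (if (q ^ h ∣ m ∧ ¬ q ^ (h + 1) ∣ m) ∧ Admissible θ q m then f m else 0) =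
      (1 - f q) * f q ^ h * ∑' m, if Admissible θ q m then f m else 0 := by
  set G : ℕ → ℂ := fun m => if Admissible θ q m then f m else 0 with hG
  have hsum : ∀ (P : ℕ → Prop) [DecidablePred P], Summable fun m => if P m then G m else 0 := fun P _ =>
    Summable.of_norm_bounded hf fun m => (norm_ite_le_norm _ _).trans (norm_ite_le_norm _ _)
  have hmul : ∀ k, ∑' m, (if q ^ k ∣ m then G m else 0) = f q ^ k * ∑' m, G m := by
    intro k
    rw [tsum_dvd_eq_tsum_mul (pow_ne_zero _ hq.ne_zero), ← tsum_mul_left]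
    refine tsum_congr fun m => ?_
    rcases eq_or_ne m 0 with rfl | hm
    · simp [hG]
    · simp [hG, admissible_pow_mul hq k hm]
  have hsub : ∀ m, (if (q ^ h ∣ m ∧ ¬ q ^ (h + 1) ∣ m) ∧ Admissible θ q m then f m else 0) =
      (if q ^ h ∣ m then G m else 0) - (if q ^ (h + 1) ∣ m then G m else 0) := by
    intro m
    have : q ^ (h + 1) ∣ m → q ^ h ∣ m := (pow_dvd_pow q (Nat.le_succ h)).trans
    by_cases h1 : q ^ (h + 1) ∣ m
    · simp [h1, this h1]
    · by_cases h2 : q ^ h ∣ m <;> simp [h1, h2, hG]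
  rw [tsum_congr hsub, (hsum _).tsum_sub (hsum _), hmul, hmul]
  ring

end

theorem lemma2_complex (θ : ℕ → WithTop ℝ)
    (hθ1 : (2 : WithTop ℝ) ≤ θ 1)
    (hθ2 : ∀ n : ℕ, 2 ≤ n → ∀ p ∈ n.primeFactors, ((p : ℝ) : WithTop ℝ) ≤ θ n)
    (q : ℕ) (hq : q.Prime) (h : ℕ) (hh : 0 < h)
    (s : ℂ) (hs : 1 < s.re) :
    (∑' n : ℕ,
      if BMem θ n ∧ q ^ h ∣ n ∧ ¬ q ^ (h + 1) ∣ n then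
        (n : ℂ) ^ (-s) *
          ∏' p : ℕ, (if p.Prime ∧ ((p : ℝ) : WithTop ℝ) ≤ θ n then 1 - (p : ℂ) ^ (-s) else 1)
      else 0)
    = (1 - (q : ℂ) ^ (-s)) / (q : ℂ) ^ (s * h) *
      ∑' n : ℕ,
        if BMem θ n ∧ ((q : ℝ) : WithTop ℝ) ≤ θ n then
          (n : ℂ) ^ (-s) *
            ∏' p : ℕ, (if p.Prime ∧ ((p : ℝ) : WithTop ℝ) ≤ θ n then 1 - (p : ℂ) ^ (-s) else 1)
        else 0 := by
  have hs0 : s ≠ 0 := Complex.ne_zero_of_one_lt_re hs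
  set f := riemannZetaSummandHom hs0
  have hf : Summable (‖f ·‖) := summable_riemannZetaSummand hs
  have hf0 : ∑' n, f n ≠ 0 := by
    rw [tsum_riemannZetaSummand hs]
    exact riemannZeta_ne_zero_of_one_lt_re hs
  have hfn : ∀ n : ℕ, (n : ℂ) ^ (-s) = f n := fun _ => rfl
  have hpow : ((q : ℂ) ^ (s * h))⁻¹ = f q ^ h := by
    rw [Complex.cpow_mul_nat, ← inv_pow, ← Complex.cpow_neg, hfn]
  have hquot : ∀ (P : ℕ → Prop) [DecidablePred P],
      ∑' n, (if P n then f n * ((∑' r, if IsRough (θ n) r then f r else 0) / ∑' n, f n) else 0) =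
        (∑' n, if P n then f n * ∑' r, (if IsRough (θ n) r then f r else 0) else 0) /
          ∑' n, f n := by
    intro P _
    rw [← tsum_div_const]
    refine tsum_congr fun n => ?_
    split_ifs
    · rw [mul_div_assoc]
    · rw [zero_div]
  simp only [hfn, tprod_le_eq_tsum_isRough_div hf hf0]
  rw [hquot, hquot,
    tsum_BMem_mul_tsum_isRough hθ2 hf (D := fun m =>
      (q ^ h ∣ m ∧ ¬ q ^ (h + 1) ∣ m) ∧ Admissible θ q m)
      fun n r hn hr => exactly_dvd_iff_admissible hθ2 hn hr hq hh,
    tsum_BMem_mul_tsum_isRough hθ2 hf (D := Admissible θ q)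
      fun n r hn hr => le_theta_iff_admissible hθ2 hn hr q,
    tsum_exactly_dvd_admissible θ hf hq h, div_eq_mul_inv (1 - f q), hpow, mul_div_assoc]
end

section
/- Let θ : ℕ → ℝ ∪ {∞} satisfy θ(1) ≥ 2 and θ(n) ≥ P⁺(n) for all n ≥ 2, where P⁺(n) is the largest prime factor of n, let χ be the characteristic function of the associated set 𝓑, and let B(x) = #{n ≤ x : n ∈ 𝓑}. Suppose B(x) = o(x) as x → ∞. Then for every prime q and every positive integer h: Σ_{n ≥ 1, q^h ∥ n} χ(n)·(1/n)·∏_{p ≤ θ(n)} (1 − 1/p) = ((1 − 1/q)/q^{h}) · Σ_{n ≥ 1, θ(n) ≥ q} χ(n)·(1/n)·∏_{p ≤ θ(n)} (1 − 1/p), where q^h ∥ n means q^h divides n but q^{h+1} does not, and p runs over primes. -/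
open scoped BigOperators
open Classical

/-- `B(x)`, the number of elements of `𝓑` that are at most `x`. -/
noncomputable def Bcount (θ : ℕ → WithTop ℝ) (x : ℝ) : ℕ :=
  Nat.card {n : ℕ | BMem θ n ∧ (n : ℝ) ≤ x}

namespace SieveDecomposition

open Filter Topology

/-! ### Euler products over the primes up to a threshold -/

/-- A product of factors in `[0, 1]` converges to the infimum of its finite subproducts. -/
theorem hasProd_iInf_of_mem_unitInterval {ι : Type*} {f : ι → ℝ} (h0 : ∀ i, 0 ≤ f i)
    (h1 : ∀ i, f i ≤ 1) : HasProd f (⨅ S : Finset ι, ∏ i ∈ S, f i) := by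
  refine tendsto_atTop_ciInf (fun S T hST => ?_) ⟨0, ?_⟩
  · exact Finset.prod_le_prod_of_subset_of_le_one hST (fun i _ => h0 i) (fun i _ _ => h1 i)
  · rintro _ ⟨S, rfl⟩
    exact Finset.prod_nonneg fun i _ => h0 i

/-- The factor at `p` of the Euler product over the primes up to `t`. -/
noncomputable def eulerFactor (t : WithTop ℝ) (s : ℝ) (p : ℕ) : ℝ :=
  if p.Prime ∧ ((p : ℝ) : WithTop ℝ) ≤ t then 1 - (p : ℝ) ^ (-s) else 1

/-- The product of `1 - p ^ (-s)` over the primes `p ≤ t`. -/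
noncomputable def sieveDensity (t : WithTop ℝ) (s : ℝ) : ℝ := ∏' p, eulerFactor t s p

theorem rpow_neg_le_half {p : ℕ} (hp : p.Prime) {s : ℝ} (hs : 1 ≤ s) :
    (p : ℝ) ^ (-s) ≤ 1 / 2 := by
  have hp2 : (2 : ℝ) ≤ p := by exact_mod_cast hp.two_le
  calc (p : ℝ) ^ (-s) ≤ (p : ℝ) ^ (-1 : ℝ) :=
        Real.rpow_le_rpow_of_exponent_le (by linarith) (by linarith)
    _ = (p : ℝ)⁻¹ := Real.rpow_neg_one _
    _ ≤ 1 / 2 := by rw [one_div]; exact inv_anti₀ (by norm_num) hp2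

theorem eulerFactor_pos (t : WithTop ℝ) {s : ℝ} (hs : 1 ≤ s) (p : ℕ) : 0 < eulerFactor t s p := by
  unfold eulerFactor
  split_ifs with h
  · linarith [rpow_neg_le_half h.1 hs]
  · exact one_pos

theorem eulerFactor_le_one (t : WithTop ℝ) (s : ℝ) (p : ℕ) : eulerFactor t s p ≤ 1 := by
  unfold eulerFactor
  split_ifs with h
  · linarith [Real.rpow_nonneg (Nat.cast_nonneg (α := ℝ) p) (-s)]
  · exact le_rfl

theorem eulerFactor_mono (t : WithTop ℝ) {s s' : ℝ} (hss : s ≤ s') (p : ℕ) :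
    eulerFactor t s p ≤ eulerFactor t s' p := by
  unfold eulerFactor
  split_ifs with h
  · have : (p : ℝ) ^ (-s') ≤ (p : ℝ) ^ (-s) :=
      Real.rpow_le_rpow_of_exponent_le (by exact_mod_cast h.1.one_lt.le) (by linarith)
    linarith
  · exact le_rfl

theorem hasProd_sieveDensity (t : WithTop ℝ) {s : ℝ} (hs : 1 ≤ s) :
    HasProd (eulerFactor t s) (sieveDensity t s) :=
  (hasProd_iInf_of_mem_unitInterval (fun p => (eulerFactor_pos t hs p).le)
    (eulerFactor_le_one t s)).multipliable.hasProd

theorem sieveDensity_nonneg (t : WithTop ℝ) {s : ℝ} (hs : 1 ≤ s) : 0 ≤ sieveDensity t s :=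
  ge_of_tendsto' (hasProd_sieveDensity t hs) fun _ =>
    Finset.prod_nonneg fun p _ => (eulerFactor_pos t hs p).le

theorem sieveDensity_mono (t : WithTop ℝ) {s s' : ℝ} (hs : 1 ≤ s) (hss : s ≤ s') :
    sieveDensity t s ≤ sieveDensity t s' :=
  le_of_tendsto_of_tendsto' (hasProd_sieveDensity t hs)
    (hasProd_sieveDensity t (hs.trans hss)) fun _ =>
    Finset.prod_le_prod (fun p _ => (eulerFactor_pos t hs p).le)
      fun p _ => eulerFactor_mono t hss p

theorem sieveDensity_le_prod (t : WithTop ℝ) {s : ℝ} (hs : 1 ≤ s) (S : Finset ℕ) :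
    sieveDensity t s ≤ ∏ p ∈ S, eulerFactor t s p := by
  refine le_of_tendsto (hasProd_sieveDensity t hs) ?_
  simp only [SummationFilter.unconditional_filter]
  filter_upwards [eventually_ge_atTop S] with T hT
  exact Finset.prod_le_prod_of_subset_of_le_one hT
    (fun p _ => (eulerFactor_pos t hs p).le) (fun p _ _ => eulerFactor_le_one t s p)

theorem sieveDensity_coe {z : ℝ} (hz : 0 ≤ z) (s : ℝ) :
    sieveDensity (z : WithTop ℝ) s = ∏ p ∈ Nat.primesLE ⌊z⌋₊, (1 - (p : ℝ) ^ (-s)) := by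
  have hmem (p : ℕ) : (p.Prime ∧ ((p : ℝ) : WithTop ℝ) ≤ z) ↔ p ∈ Nat.primesLE ⌊z⌋₊ := by
    rw [WithTop.coe_le_coe, Nat.mem_primesLE, Nat.le_floor_iff hz, and_comm]
  rw [sieveDensity, tprod_eq_prod (s := Nat.primesLE ⌊z⌋₊)]
  · exact Finset.prod_congr rfl fun p hp => if_pos ((hmem p).2 hp)
  · exact fun p hp => if_neg (fun h => hp ((hmem p).1 h))

theorem tendsto_sieveDensity_coe {z : ℝ} (hz : 0 ≤ z) :
    Tendsto (sieveDensity (z : WithTop ℝ)) (𝓝[>] 1) (𝓝 (sieveDensity (z : WithTop ℝ) 1)) := by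
  have h : sieveDensity (z : WithTop ℝ) =
      fun s => ∏ p ∈ Nat.primesLE ⌊z⌋₊, (1 - (p : ℝ) ^ (-s)) := funext (sieveDensity_coe hz)
  rw [h]
  refine tendsto_nhdsWithin_of_tendsto_nhds (tendsto_finsetProd _ fun p hp => ?_)
  have hp0 : (p : ℝ) ≠ 0 := by exact_mod_cast (Nat.mem_primesLE.1 hp).2.ne_zero
  exact tendsto_const_nhds.sub
    ((Real.continuousAt_const_rpow hp0).comp continuousAt_neg)

/-- `n ↦ n ^ (-s)` as a homomorphism of monoids with zero. -/
noncomputable def rpowNegHom (s : ℝ) (hs : s ≠ 0) : ℕ →*₀ ℝ where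
  toFun n := (n : ℝ) ^ (-s)
  map_zero' := by simp [Real.zero_rpow (neg_ne_zero.2 hs)]
  map_one' := by simp
  map_mul' a b := by
    push_cast; exact Real.mul_rpow (Nat.cast_nonneg a) (Nat.cast_nonneg b)

theorem summable_rpow_neg {s : ℝ} (hs : 1 < s) : Summable fun n : ℕ => (n : ℝ) ^ (-s) :=
  Real.summable_nat_rpow.2 (by linarith)

theorem sum_rpow_neg_mul_prod_le_one {s : ℝ} (hs : 1 < s) (N : ℕ) :
    (∑ n ∈ Finset.Icc 1 N, (n : ℝ) ^ (-s)) * ∏ p ∈ Nat.primesBelow (N + 1), (1 - (p : ℝ) ^ (-s))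
      ≤ 1 := by
  have hs0 : s ≠ 0 := by linarith
  have hsum : Summable (rpowNegHom s hs0 : ℕ →* ℝ) := summable_rpow_neg hs
  have hE := EulerProduct.prod_primesBelow_geometric_eq_tsum_smoothNumbers hsum (N + 1)
  have hle : ∑ n ∈ Finset.Icc 1 N, (n : ℝ) ^ (-s) ≤
      ∑' m : (N + 1).smoothNumbers, (rpowNegHom s hs0 : ℕ →* ℝ) m := by
    rw [tsum_subtype (N + 1).smoothNumbers (rpowNegHom s hs0 : ℕ →* ℝ)]
    have hpos (n : ℕ) : 0 ≤ (n : ℝ) ^ (-s) := Real.rpow_nonneg (Nat.cast_nonneg n) _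
    calc ∑ n ∈ Finset.Icc 1 N, (n : ℝ) ^ (-s)
        = ∑ n ∈ Finset.Icc 1 N,
            (N + 1).smoothNumbers.indicator (rpowNegHom s hs0 : ℕ →* ℝ) n := by
          refine Finset.sum_congr rfl fun n hn => ?_
          rw [Finset.mem_Icc] at hn
          rw [Set.indicator_of_mem (Nat.mem_smoothNumbers_of_lt hn.1 (by omega))]
          rfl
      _ ≤ _ := (hsum.indicator _).sum_le_tsum _ fun n _ =>
          Set.indicator_nonneg (fun n _ => hpos n) n
  have hprod : 0 < ∏ p ∈ Nat.primesBelow (N + 1), (1 - (p : ℝ) ^ (-s)) :=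
    Finset.prod_pos fun p hp => by
      linarith [rpow_neg_le_half (Nat.prime_of_mem_primesBelow hp) hs.le]
  rw [← hE, Finset.prod_inv_distrib] at hle
  calc _ ≤ _ := mul_le_mul_of_nonneg_right hle hprod.le
    _ = 1 := inv_mul_cancel₀ hprod.ne'

/-- Once the threshold exceeds `exp (1 / (s - 1))`, the density is `O(s - 1)`. -/
theorem sieveDensity_le_of_exp_le {t : WithTop ℝ} {s : ℝ} (hs : 1 < s)
    (ht : ((Real.exp (1 / (s - 1)) : ℝ) : WithTop ℝ) ≤ t) :
    sieveDensity t s ≤ Real.exp 1 * (s - 1) := by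
  set z := Real.exp (1 / (s - 1)) with hz
  have hs1 : 0 < s - 1 := by linarith
  have hz0 : 0 < z := Real.exp_pos _
  set N := ⌊z⌋₊
  have hlog : Real.exp (-1) * (1 / (s - 1)) ≤ ∑ n ∈ Finset.Icc 1 N, (n : ℝ) ^ (-s) := by
    have h1 := log_le_harmonic_floor z hz0.le
    rw [hz, Real.log_exp, ← hz, harmonic_eq_sum_Icc] at h1
    push_cast at h1
    refine (mul_le_mul_of_nonneg_left h1 (Real.exp_pos _).le).trans ?_
    rw [Finset.mul_sum]
    refine Finset.sum_le_sum fun n hn => ?_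
    rw [Finset.mem_Icc] at hn
    have hn0 : (0 : ℝ) < n := by exact_mod_cast hn.1
    have hnz : (n : ℝ) ≤ z := (Nat.le_floor_iff hz0.le).1 hn.2
    have hlogn : Real.log n ≤ 1 / (s - 1) := by
      rw [← Real.log_exp (1 / (s - 1))]; exact Real.log_le_log hn0 hnz
    rw [le_div_iff₀ hs1] at hlogn
    rw [← Real.exp_log (inv_pos.2 hn0), ← Real.exp_add, Real.rpow_def_of_pos hn0, Real.log_inv]
    exact Real.exp_le_exp.2 (by nlinarith)
  have hprod : sieveDensity t s ≤ ∏ p ∈ Nat.primesBelow (N + 1), (1 - (p : ℝ) ^ (-s)) := by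
    refine (sieveDensity_le_prod t hs.le (Nat.primesBelow (N + 1))).trans_eq ?_
    refine Finset.prod_congr rfl fun p hp => if_pos ⟨Nat.prime_of_mem_primesBelow hp, ?_⟩
    refine le_trans (WithTop.coe_le_coe.2 ?_) ht
    exact (Nat.le_floor_iff hz0.le).1 (Nat.lt_succ_iff.1 (Nat.lt_of_mem_primesBelow hp))
  have hmain : Real.exp (-1) * (1 / (s - 1)) * sieveDensity t s ≤ 1 :=
    (mul_le_mul hlog hprod (sieveDensity_nonneg t hs.le)
      (Finset.sum_nonneg fun n _ => Real.rpow_nonneg (Nat.cast_nonneg n) _)).trans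
      (sum_rpow_neg_mul_prod_le_one hs N)
  have : sieveDensity t s =
      Real.exp 1 * (s - 1) * (Real.exp (-1) * (1 / (s - 1)) * sieveDensity t s) := by
    rw [Real.exp_neg]; field_simp
  rw [this]
  exact mul_le_of_le_one_right (by positivity) hmain

theorem sieveDensity_top : sieveDensity ⊤ 1 = 0 := by
  refine le_antisymm (le_of_forall_pos_le_add fun ε hε => ?_) (sieveDensity_nonneg _ le_rfl)
  have hs : 1 < 1 + ε / Real.exp 1 := by have := Real.exp_pos 1; simp; positivity
  calc sieveDensity ⊤ 1 ≤ sieveDensity ⊤ (1 + ε / Real.exp 1) :=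
        sieveDensity_mono _ le_rfl hs.le
    _ ≤ _ := sieveDensity_le_of_exp_le hs le_top
    _ = 0 + ε := by have := (Real.exp_pos 1).ne'; field_simp; ring

/-- The upper bound in Mertens' first theorem. -/
theorem sum_log_div_prime_le (N : ℕ) :
    ∑ p ∈ Nat.primesLE N, Real.log p / p ≤ Real.log N + Real.log 4 := by
  rcases N.eq_zero_or_pos with rfl | hN
  · rw [show Nat.primesLE 0 = ∅ by decide]; simp; positivity
  have hN0 : (0 : ℝ) < N := by exact_mod_cast hN
  have hfac (p : ℕ) (hp : p ∈ Nat.primesLE N) : N / p ≤ N.factorial.factorization p := by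
    obtain ⟨hpN, hpp⟩ := Nat.mem_primesLE.1 hp
    rw [Nat.factorization_factorial hpp (Nat.lt_succ_self (Nat.log p N))]
    have h1 : 1 ∈ Finset.Ico 1 (Nat.log p N).succ := by
      simp [Nat.log_pos hpp.one_lt hpN]
    simpa using Finset.single_le_sum (f := fun i => N / p ^ i) (fun _ _ => Nat.zero_le _) h1
  have h1 : ∑ p ∈ Nat.primesLE N, ((N / p : ℕ) : ℝ) * Real.log p ≤ Real.log N.factorial := by
    rw [Real.log_nat_eq_sum_factorization, Finsupp.sum]
    have hlog (p : ℕ) : 0 ≤ Real.log p := Real.log_natCast_nonneg p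
    refine (Finset.sum_le_sum fun p hp => mul_le_mul_of_nonneg_right
      (Nat.cast_le.2 (hfac p hp)) (hlog p)).trans ?_
    refine Finset.sum_le_sum_of_subset_of_nonneg (fun p hp => ?_) fun p _ _ =>
      mul_nonneg (Nat.cast_nonneg _) (hlog p)
    obtain ⟨hpN, hpp⟩ := Nat.mem_primesLE.1 hp
    rw [Nat.support_factorization, Nat.mem_primeFactors]
    exact ⟨hpp, hpp.dvd_factorial.2 hpN, N.factorial_ne_zero⟩
  have h2 : Real.log N.factorial ≤ N * Real.log N := by
    rw [← Real.log_pow]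
    exact Real.log_le_log (by exact_mod_cast N.factorial_pos)
      (by exact_mod_cast Nat.factorial_le_pow N)
  have h3 : ∑ p ∈ Nat.primesLE N, Real.log p ≤ Real.log 4 * N := by
    rw [← Chebyshev.theta_eq_sum_primesLE_log]
    exact Chebyshev.theta_le_log4_mul_x hN0.le
  have h4 : N * ∑ p ∈ Nat.primesLE N, Real.log p / p ≤
      ∑ p ∈ Nat.primesLE N, ((N / p : ℕ) : ℝ) * Real.log p + ∑ p ∈ Nat.primesLE N, Real.log p := by
    rw [Finset.mul_sum, ← Finset.sum_add_distrib]
    refine Finset.sum_le_sum fun p hp => ?_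
    have hf : (N : ℝ) / p ≤ ((N / p : ℕ) : ℝ) + 1 := by
      rw [← Nat.floor_div_eq_div (K := ℝ)]; exact (Nat.lt_floor_add_one _).le
    nlinarith [mul_le_mul_of_nonneg_right hf (Real.log_natCast_nonneg p),
      show (N : ℝ) * (Real.log p / p) = N / p * Real.log p by ring]
  refine le_of_mul_le_mul_left (h4.trans ?_) hN0
  linarith

/-- Below `exp (1 / (s - 1))` the density at `s` is comparable with the density at `1`. -/
theorem sieveDensity_coe_le {z s : ℝ} (hz : 1 ≤ z) (hs : 1 < s) (hs2 : s ≤ 2)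
    (hzs : z ≤ Real.exp (1 / (s - 1))) :
    sieveDensity (z : WithTop ℝ) s ≤
      Real.exp (2 + 2 * Real.log 4) * sieveDensity (z : WithTop ℝ) 1 := by
  have hs1 : 0 < s - 1 := by linarith
  rw [sieveDensity_coe (by linarith), sieveDensity_coe (by linarith)]
  have hfactor (p : ℕ) (hp : p ∈ Nat.primesLE ⌊z⌋₊) : 1 - (p : ℝ) ^ (-s) ≤
      Real.exp (2 * (s - 1) * (Real.log p / p)) * (1 - (p : ℝ) ^ (-(1 : ℝ))) := by
    have hpp := (Nat.mem_primesLE.1 hp).2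
    have hp0 : (0 : ℝ) < p := by exact_mod_cast hpp.pos
    have hhalf := rpow_neg_le_half hpp le_rfl
    have hexp := Real.add_one_le_exp (-(s - 1) * Real.log p)
    have hsplit : (p : ℝ) ^ (-s) = (p : ℝ) ^ (-(1 : ℝ)) * Real.exp (-(s - 1) * Real.log p) := by
      rw [Real.rpow_def_of_pos hp0, Real.rpow_def_of_pos hp0, ← Real.exp_add]; ring_nf
    have hinv : (p : ℝ) ^ (-(1 : ℝ)) = 1 / p := by rw [Real.rpow_neg_one, one_div]
    have hu : 0 ≤ (s - 1) * (Real.log p / p) :=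
      mul_nonneg hs1.le (div_nonneg (Real.log_natCast_nonneg p) hp0.le)
    have hlow : (p : ℝ) ^ (-(1 : ℝ)) - (s - 1) * (Real.log p / p) ≤ (p : ℝ) ^ (-s) := by
      rw [hsplit]
      have := mul_le_mul_of_nonneg_left hexp (show 0 ≤ (p : ℝ) ^ (-(1 : ℝ)) by positivity)
      refine le_trans (le_of_eq ?_) this
      rw [hinv]; ring
    have hexp2 := Real.add_one_le_exp (2 * (s - 1) * (Real.log p / p))
    have hpos : 0 ≤ 1 - (p : ℝ) ^ (-(1 : ℝ)) := by linarith
    refine le_trans ?_ (mul_le_mul_of_nonneg_right hexp2 hpos)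
    nlinarith
  refine (Finset.prod_le_prod (fun p hp => ?_) hfactor).trans ?_
  · linarith [rpow_neg_le_half (Nat.mem_primesLE.1 hp).2 hs.le]
  rw [Finset.prod_mul_distrib, ← Real.exp_sum, ← Finset.mul_sum]
  refine mul_le_mul_of_nonneg_right (Real.exp_le_exp.2 ?_) (Finset.prod_nonneg fun p hp => ?_)
  · have hM := sum_log_div_prime_le ⌊z⌋₊
    have hfl : Real.log ⌊z⌋₊ ≤ 1 / (s - 1) := by
      rw [← Real.log_exp (1 / (s - 1))]
      exact Real.log_le_log (by exact_mod_cast Nat.floor_pos.2 hz)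
        ((Nat.floor_le (by linarith)).trans hzs)
    have h4 : 0 ≤ Real.log 4 := Real.log_nonneg (by norm_num)
    calc 2 * (s - 1) * ∑ p ∈ Nat.primesLE ⌊z⌋₊, Real.log p / p
        ≤ 2 * (s - 1) * (1 / (s - 1) + Real.log 4) :=
          mul_le_mul_of_nonneg_left (by linarith) (by linarith)
      _ = 2 + 2 * (s - 1) * Real.log 4 := by field_simp
      _ ≤ 2 + 2 * Real.log 4 := by nlinarith
  · linarith [rpow_neg_le_half (Nat.mem_primesLE.1 hp).2 le_rfl]

/-! ### The part of an integer composed of small primes -/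

/-- The part of `m` composed of primes less than `x`. -/
noncomputable def lowPart (m x : ℕ) : ℕ :=
  ∏ q ∈ m.primeFactors.filter (fun q => q < x), q ^ m.factorization q

theorem factorization_lowPart (m x p : ℕ) :
    (lowPart m x).factorization p = if p < x then m.factorization p else 0 := by
  have h : lowPart m x = (m.factorization.filter (fun q => q < x)).prod (· ^ ·) := by
    rw [Finsupp.prod, Finsupp.support_filter, Nat.support_factorization, lowPart]
    exact Finset.prod_congr rfl fun q hq => by
      rw [Finsupp.filter_apply_pos (fun q => q < x) _ (Finset.mem_filter.1 hq).2]
  rw [h, Nat.prod_pow_factorization_eq_self, Finsupp.filter_apply]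
  intro q hq
  rw [Finsupp.support_filter, Nat.support_factorization] at hq
  exact Nat.prime_of_mem_primeFactors (Finset.mem_filter.1 hq).1

theorem lowPart_ne_zero (m x : ℕ) : lowPart m x ≠ 0 :=
  Finset.prod_ne_zero_iff.2 fun _ hq =>
    pow_ne_zero _ (Nat.prime_of_mem_primeFactors (Finset.mem_filter.1 hq).1).ne_zero

theorem lowPart_congr {m m' x : ℕ}
    (h : ∀ p, p.Prime → p < x → m.factorization p = m'.factorization p) :
    lowPart m x = lowPart m' x := by
  refine Nat.eq_of_factorization_eq (lowPart_ne_zero m x) (lowPart_ne_zero m' x) fun p => ?_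
  rw [factorization_lowPart, factorization_lowPart]
  split_ifs with hp
  · by_cases hpp : p.Prime
    · exact h p hpp hp
    · rw [Nat.factorization_eq_zero_of_not_prime _ hpp,
        Nat.factorization_eq_zero_of_not_prime _ hpp]
  · rfl

theorem lowPart_lowPart {m x y : ℕ} (h : x ≤ y) : lowPart (lowPart m y) x = lowPart m x :=
  lowPart_congr fun p _ hpx => by rw [factorization_lowPart, if_pos (hpx.trans_le h)]

theorem lowPart_eq_self {m x : ℕ} (hm : m ≠ 0) (h : ∀ p, p.Prime → p ∣ m → p < x) :
    lowPart m x = m := by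
  refine Nat.eq_of_factorization_eq (lowPart_ne_zero m x) hm fun p => ?_
  rw [factorization_lowPart]
  split_ifs with hp
  · rfl
  · by_cases hpp : p.Prime
    · exact (Nat.factorization_eq_zero_of_not_dvd fun hd => hp (h p hpp hd)).symm
    · exact (Nat.factorization_eq_zero_of_not_prime _ hpp).symm

theorem lowPart_mul_of_le {n r x : ℕ} (hn : n ≠ 0) (hr : r ≠ 0)
    (h : ∀ p, p.Prime → p ∣ r → x ≤ p) : lowPart (n * r) x = lowPart n x :=
  lowPart_congr fun p hp hpx => by
    rw [Nat.factorization_mul hn hr, Finsupp.add_apply,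
      Nat.factorization_eq_zero_of_not_dvd fun hd => hpx.not_ge (h p hp hd), add_zero]

theorem dvd_lowPart_iff {m x p : ℕ} (hm : m ≠ 0) (hp : p.Prime) :
    p ∣ lowPart m x ↔ p ∣ m ∧ p < x := by
  rw [hp.dvd_iff_one_le_factorization (lowPart_ne_zero m x), factorization_lowPart,
    hp.dvd_iff_one_le_factorization hm]
  split_ifs with h <;> simp [h]

theorem exists_eq_lowPart_mul {m : ℕ} (hm : m ≠ 0) (x : ℕ) :
    ∃ r, r ≠ 0 ∧ m = lowPart m x * r ∧ ∀ p, p.Prime → p ∣ r → x ≤ p := by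
  have hd : lowPart m x ∣ m := by
    refine (Nat.factorization_prime_le_iff_dvd (lowPart_ne_zero m x) hm).1 fun p _ => ?_
    rw [factorization_lowPart]; split_ifs <;> simp
  obtain ⟨r, hr⟩ := hd
  have hr0 : r ≠ 0 := by rintro rfl; exact hm (by simpa using hr)
  refine ⟨r, hr0, hr, fun p hp hpr => ?_⟩
  by_contra! hlt
  have h1 : m.factorization p = (lowPart m x * r).factorization p := by rw [← hr]
  rw [Nat.factorization_mul (lowPart_ne_zero m x) hr0, Finsupp.add_apply, factorization_lowPart,
    if_pos hlt] at h1
  have := (hp.dvd_iff_one_le_factorization hr0).1 hpr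
  omega

/-! ### Unique decomposition into an element of the set and a rough cofactor -/

/-- The positive integers all of whose prime factors exceed `t`. -/
def roughSet (t : WithTop ℝ) : Set ℕ :=
  {r | r ≠ 0 ∧ ∀ p, p.Prime → p ∣ r → t < ((p : ℝ) : WithTop ℝ)}

/-- `θ n` is at least every prime factor of `n`. -/
def DominatesPrimes (θ : ℕ → WithTop ℝ) : Prop :=
  ∀ n p : ℕ, n ≠ 0 → p.Prime → p ∣ n → ((p : ℝ) : WithTop ℝ) ≤ θ n

theorem bMem_iff {θ : ℕ → WithTop ℝ} {n : ℕ} : BMem θ n ↔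
    n ≠ 0 ∧ ∀ p, p.Prime → p ∣ n → ((p : ℝ) : WithTop ℝ) ≤ θ (lowPart n p) := by
  rw [BMem, Nat.pos_iff_ne_zero]
  refine and_congr_right fun hn => ⟨fun h p hp hd => h p (Nat.mem_primeFactors.2 ⟨hp, hd, hn⟩),
    fun h p hp => ?_⟩
  exact h p (Nat.prime_of_mem_primeFactors hp) (Nat.dvd_of_mem_primeFactors hp)

theorem natCast_le_natCast_withTop {a b : ℕ} :
    ((a : ℝ) : WithTop ℝ) ≤ ((b : ℝ) : WithTop ℝ) ↔ a ≤ b := by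
  rw [WithTop.coe_le_coe, Nat.cast_le]

theorem natCast_lt_natCast_withTop {a b : ℕ} :
    ((a : ℝ) : WithTop ℝ) < ((b : ℝ) : WithTop ℝ) ↔ a < b := by
  rw [WithTop.coe_lt_coe, Nat.cast_lt]

theorem exists_bMem_mul_rough (θ : ℕ → WithTop ℝ) {m : ℕ} (hm : m ≠ 0) :
    ∃ n r, BMem θ n ∧ r ∈ roughSet (θ n) ∧ n * r = m := by
  by_cases hB : BMem θ m
  · exact ⟨m, 1, hB, ⟨one_ne_zero, fun p hp hd => absurd (Nat.dvd_one.1 hd) hp.ne_one⟩, mul_one m⟩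
  have hex : ∃ p, p.Prime ∧ p ∣ m ∧ ¬ ((p : ℝ) : WithTop ℝ) ≤ θ (lowPart m p) := by
    by_contra! h
    exact hB (bMem_iff.2 ⟨hm, h⟩)
  set p := Nat.find hex with hp_def
  obtain ⟨hp, -, hpθ⟩ := Nat.find_spec hex
  rw [← hp_def] at hp hpθ
  obtain ⟨r, hr0, hmr, hr⟩ := exists_eq_lowPart_mul hm p
  refine ⟨lowPart m p, r, bMem_iff.2 ⟨lowPart_ne_zero m p, fun p' hp' hd => ?_⟩, ⟨hr0, ?_⟩,
    hmr.symm⟩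
  · obtain ⟨hd', hlt⟩ := (dvd_lowPart_iff hm hp').1 hd
    rw [lowPart_lowPart hlt.le]
    by_contra hcon
    exact Nat.find_min hex hlt ⟨hp', hd', hcon⟩
  · exact fun p' hp' hd => (not_le.1 hpθ).trans_le (natCast_le_natCast_withTop.2 (hr p' hp' hd))

theorem eq_of_bMem_mul_rough_of_le {θ : ℕ → WithTop ℝ} (hθ : DominatesPrimes θ) {n r n' r' : ℕ}
    (hn : BMem θ n) (hr : r ∈ roughSet (θ n)) (hn' : BMem θ n') (hr' : r' ∈ roughSet (θ n'))
    (h : n * r = n' * r') (hle : θ n ≤ θ n') : n = n' := by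
  rw [bMem_iff] at hn hn'
  have hfac (p : ℕ) (hp : p.Prime) : (p : ℕ) ∣ r → (p ∣ n → False) := fun hd hdn =>
    (hr.2 p hp hd).not_ge (hθ n p hn.1 hp hdn)
  have hsum (p : ℕ) : n.factorization p + r.factorization p =
      n'.factorization p + r'.factorization p := by
    have := congrArg (fun k => k.factorization p) h
    simpa [Nat.factorization_mul hn.1 hr.1, Nat.factorization_mul hn'.1 hr'.1] using this
  have hr'0 (p : ℕ) (hp : p.Prime) (hpθ : ((p : ℝ) : WithTop ℝ) ≤ θ n') :
      r'.factorization p = 0 :=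
    Nat.factorization_eq_zero_of_not_dvd fun hd => (hr'.2 p hp hd).not_ge hpθ
  have hr0 (p : ℕ) (hp : p.Prime) (hpθ : ((p : ℝ) : WithTop ℝ) ≤ θ n) :
      r.factorization p = 0 :=
    Nat.factorization_eq_zero_of_not_dvd fun hd => (hr.2 p hp hd).not_ge hpθ
  have hsame (p : ℕ) (hp : p.Prime) (hpθ : ((p : ℝ) : WithTop ℝ) ≤ θ n) :
      n.factorization p = n'.factorization p := by
    have := hsum p
    rw [hr0 p hp hpθ, hr'0 p hp (hpθ.trans hle)] at this
    simpa using this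
  have hbig : ¬ ∃ p, p.Prime ∧ p ∣ n' ∧ θ n < ((p : ℝ) : WithTop ℝ) := by
    intro hex
    set p := Nat.find hex with hp_def
    obtain ⟨hp, hpn', hpθ⟩ := Nat.find_spec hex
    rw [← hp_def] at hp hpn' hpθ
    have hlow : lowPart n' p = n := by
      rw [← lowPart_eq_self (m := n) (x := p) hn.1 fun p' hp' hd =>
        natCast_lt_natCast_withTop.1 ((hθ n p' hn.1 hp' hd).trans_lt hpθ)]
      refine lowPart_congr fun p' hp' hlt => ?_
      by_cases hp'θ : ((p' : ℝ) : WithTop ℝ) ≤ θ n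
      · exact (hsame p' hp' hp'θ).symm
      · rw [Nat.factorization_eq_zero_of_not_dvd fun hd => hp'θ (hθ n p' hn.1 hp' hd),
          Nat.factorization_eq_zero_of_not_dvd fun hd =>
            Nat.find_min hex hlt ⟨hp', hd, not_le.1 hp'θ⟩]
    have := hn'.2 p hp hpn'
    rw [hlow] at this
    exact hpθ.not_ge this
  refine Nat.eq_of_factorization_eq hn.1 hn'.1 fun p => ?_
  by_cases hp : p.Prime
  · by_cases hpθ : ((p : ℝ) : WithTop ℝ) ≤ θ n
    · exact hsame p hp hpθ
    · rw [Nat.factorization_eq_zero_of_not_dvd fun hd => hpθ (hθ n p hn.1 hp hd),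
        Nat.factorization_eq_zero_of_not_dvd fun hd => hbig ⟨p, hp, hd, not_le.1 hpθ⟩]
  · rw [Nat.factorization_eq_zero_of_not_prime _ hp, Nat.factorization_eq_zero_of_not_prime _ hp]

theorem eq_of_bMem_mul_rough {θ : ℕ → WithTop ℝ} (hθ : DominatesPrimes θ) {n r n' r' : ℕ}
    (hn : BMem θ n) (hr : r ∈ roughSet (θ n)) (hn' : BMem θ n') (hr' : r' ∈ roughSet (θ n'))
    (h : n * r = n' * r') : n = n' := by
  rcases le_total (θ n) (θ n') with hle | hle
  · exact eq_of_bMem_mul_rough_of_le hθ hn hr hn' hr' h hle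
  · exact (eq_of_bMem_mul_rough_of_le hθ hn' hr' hn hr h.symm hle).symm

/-- The unique `n ∈ 𝓑` such that `m / n` has all its prime factors above `θ n`. -/
noncomputable def core (θ : ℕ → WithTop ℝ) (m : ℕ) : ℕ :=
  if hm : m ≠ 0 then (exists_bMem_mul_rough θ hm).choose else 0

theorem core_spec (θ : ℕ → WithTop ℝ) {m : ℕ} (hm : m ≠ 0) :
    BMem θ (core θ m) ∧ ∃ r ∈ roughSet (θ (core θ m)), core θ m * r = m := by
  rw [core, dif_pos hm]
  obtain ⟨r, h1, h2, h3⟩ := (exists_bMem_mul_rough θ hm).choose_spec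
  exact ⟨h1, r, h2, h3⟩

theorem core_mul {θ : ℕ → WithTop ℝ} (hθ : DominatesPrimes θ) {n r : ℕ} (hn : BMem θ n)
    (hr : r ∈ roughSet (θ n)) : core θ (n * r) = n := by
  obtain ⟨h1, r', h2, h3⟩ := core_spec θ (mul_ne_zero hn.1.ne' hr.1)
  exact eq_of_bMem_mul_rough hθ h1 h2 hn hr h3

theorem preimage_core {θ : ℕ → WithTop ℝ} (hθ : DominatesPrimes θ) {n : ℕ} (hn : BMem θ n) :
    core θ ⁻¹' {n} = (n * ·) '' roughSet (θ n) := by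
  ext m
  constructor
  · rintro (h : core θ m = n)
    rcases eq_or_ne m 0 with rfl | hm
    · simp only [core, ne_eq, not_true_eq_false, dite_false] at h
      exact absurd h.symm hn.1.ne'
    · obtain ⟨-, r, h2, h3⟩ := core_spec θ hm
      rw [h] at h2 h3
      exact ⟨r, h2, h3⟩
  · rintro ⟨r, hr, rfl⟩
    exact core_mul hθ hn hr

/-- A condition on the part of `m` below `q`, equivalent to `q ≤ θ (core θ m)`. -/
def ReachesBound (θ : ℕ → WithTop ℝ) (q m : ℕ) : Prop :=
  (∀ p, p.Prime → p ∣ m → p < q → ((p : ℝ) : WithTop ℝ) ≤ θ (lowPart m p)) ∧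
    ((q : ℝ) : WithTop ℝ) ≤ θ (lowPart m q)

theorem reachesBound_mul_right {θ : ℕ → WithTop ℝ} {q n r : ℕ} (hn : n ≠ 0) (hr : r ≠ 0)
    (h : ∀ p, p.Prime → p ∣ r → q ≤ p) : ReachesBound θ q (n * r) ↔ ReachesBound θ q n := by
  unfold ReachesBound
  rw [lowPart_mul_of_le hn hr h]
  refine and_congr_left fun _ => forall₂_congr fun p hp => ?_
  constructor
  · intro H hd hlt
    rw [← lowPart_mul_of_le hn hr fun p' hp' hd' => hlt.le.trans (h p' hp' hd')]
    exact H (hd.mul_right r) hlt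
  · intro H hd hlt
    rw [lowPart_mul_of_le hn hr fun p' hp' hd' => hlt.le.trans (h p' hp' hd')]
    exact H ((hp.dvd_mul.1 hd).resolve_right fun hd' => hlt.not_ge (h p hp hd')) hlt

theorem reachesBound_of_bMem {θ : ℕ → WithTop ℝ} {q n : ℕ} (hn : BMem θ n)
    (hq : ((q : ℝ) : WithTop ℝ) ≤ θ n) : ReachesBound θ q n := by
  rw [bMem_iff] at hn
  refine ⟨fun p hp hd _ => hn.2 p hp hd, ?_⟩
  by_cases hex : ∃ p, p.Prime ∧ p ∣ n ∧ q ≤ p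
  · set p := Nat.find hex with hp_def
    obtain ⟨hp, hd, hqp⟩ := Nat.find_spec hex
    rw [← hp_def] at hp hd hqp
    have hlow : lowPart n q = lowPart n p := by
      rw [← lowPart_lowPart hqp]
      refine lowPart_eq_self (lowPart_ne_zero n p) fun p' hp' hd' => ?_
      obtain ⟨hd'n, hlt⟩ := (dvd_lowPart_iff hn.1 hp').1 hd'
      by_contra! hge
      exact Nat.find_min hex hlt ⟨hp', hd'n, hge⟩
    rw [hlow]
    exact (natCast_le_natCast_withTop.2 hqp).trans (hn.2 p hp hd)
  · push Not at hex
    rwa [lowPart_eq_self hn.1 hex]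

theorem reachesBound_mul_iff {θ : ℕ → WithTop ℝ} (hθ : DominatesPrimes θ) {q n r : ℕ}
    (hn : BMem θ n) (hr : r ∈ roughSet (θ n)) :
    ReachesBound θ q (n * r) ↔ ((q : ℝ) : WithTop ℝ) ≤ θ n := by
  have hn0 := hn.1.ne'
  constructor
  · rintro ⟨h1, h2⟩
    by_contra! hlt
    have hnp (p : ℕ) (hp : p.Prime) (hd : p ∣ n) : ((p : ℝ) : WithTop ℝ) ≤ θ n := hθ n p hn0 hp hd
    by_cases hex : ∃ p, p.Prime ∧ p ∣ r ∧ p < q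
    · set p := Nat.find hex with hp_def
      obtain ⟨hp, hd, hpq⟩ := Nat.find_spec hex
      rw [← hp_def] at hp hd hpq
      have h3 := h1 p hp (hd.mul_left n) hpq
      rw [lowPart_mul_of_le hn0 hr.1, lowPart_eq_self hn0] at h3
      · exact (hr.2 p hp hd).not_ge h3
      · exact fun p' hp' hd' =>
          natCast_lt_natCast_withTop.1 ((hnp p' hp' hd').trans_lt (hr.2 p hp hd))
      · intro p' hp' hd'
        by_contra! hlt'
        exact Nat.find_min hex hlt' ⟨hp', hd', hlt'.trans hpq⟩
    · push Not at hex
      rw [lowPart_mul_of_le hn0 hr.1 hex, lowPart_eq_self hn0] at h2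
      · exact hlt.not_ge h2
      · exact fun p' hp' hd' => natCast_lt_natCast_withTop.1 ((hnp p' hp' hd').trans_lt hlt)
  · intro hq
    rw [reachesBound_mul_right hn0 hr.1 fun p hp hd =>
      natCast_le_natCast_withTop.1 (hq.trans (hr.2 p hp hd).le)]
    exact reachesBound_of_bMem hn hq

theorem le_core_iff {θ : ℕ → WithTop ℝ} (hθ : DominatesPrimes θ) {q m : ℕ} (hm : m ≠ 0) :
    ((q : ℝ) : WithTop ℝ) ≤ θ (core θ m) ↔ ReachesBound θ q m := by
  obtain ⟨h1, r, h2, h3⟩ := core_spec θ hm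
  rw [← reachesBound_mul_iff hθ h1 h2, h3]

theorem exactPow_core_iff {θ : ℕ → WithTop ℝ} (hθ : DominatesPrimes θ) {q h m : ℕ}
    (hq : q.Prime) (hh : 0 < h) (hm : m ≠ 0) :
    (q ^ h ∣ core θ m ∧ ¬ q ^ (h + 1) ∣ core θ m) ↔
      ReachesBound θ q m ∧ q ^ h ∣ m ∧ ¬ q ^ (h + 1) ∣ m := by
  obtain ⟨h1, r, h2, h3⟩ := core_spec θ hm
  have key (hle : ((q : ℝ) : WithTop ℝ) ≤ θ (core θ m)) (k : ℕ) : q ^ k ∣ core θ m ↔ q ^ k ∣ m := by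
    have hcop : Nat.Coprime (q ^ k) r :=
      ((hq.coprime_iff_not_dvd).2 fun hd => (h2.2 q hq hd).not_ge hle).pow_left k
    conv_rhs => rw [← h3]
    exact (hcop.dvd_mul_right).symm
  rw [← le_core_iff hθ hm]
  constructor
  · rintro ⟨ha, hb⟩
    have hle := hθ _ q h1.1.ne' hq ((dvd_pow_self q hh.ne').trans ha)
    exact ⟨hle, (key hle h).1 ha, fun hc => hb ((key hle _).2 hc)⟩
  · rintro ⟨hle, ha, hb⟩
    exact ⟨(key hle h).2 ha, fun hc => hb ((key hle _).1 hc)⟩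

theorem reachesBound_prime_mul_iff {θ : ℕ → WithTop ℝ} {q m : ℕ} (hq : q.Prime) (hm : m ≠ 0) :
    ReachesBound θ q (q * m) ↔ ReachesBound θ q m := by
  rw [mul_comm]
  exact reachesBound_mul_right hm hq.ne_zero fun p hp hd =>
    ((Nat.prime_dvd_prime_iff_eq hp hq).1 hd).ge

/-! ### Dirichlet series of the decomposition -/

theorem mul_mem_roughSet {t : WithTop ℝ} {a b : ℕ} :
    a * b ∈ roughSet t ↔ a ∈ roughSet t ∧ b ∈ roughSet t := by
  simp only [roughSet, Set.mem_ofPred_eq, mul_ne_zero_iff]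
  constructor
  · rintro ⟨⟨ha, hb⟩, h⟩
    exact ⟨⟨ha, fun p hp hd => h p hp (hd.mul_right b)⟩, hb, fun p hp hd => h p hp (hd.mul_left a)⟩
  · rintro ⟨⟨ha, h1⟩, hb, h2⟩
    exact ⟨⟨ha, hb⟩, fun p hp hd => (hp.dvd_mul.1 hd).elim (h1 p hp) (h2 p hp)⟩

theorem prime_mem_roughSet {t : WithTop ℝ} {p : ℕ} (hp : p.Prime) :
    p ∈ roughSet t ↔ t < ((p : ℝ) : WithTop ℝ) :=
  ⟨fun h => h.2 p hp dvd_rfl, fun h => ⟨hp.ne_zero, fun p' hp' hd => by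
    rwa [(Nat.prime_dvd_prime_iff_eq hp' hp).1 hd]⟩⟩

/-- `n ↦ n ^ (-s)` restricted to the integers without prime factors up to `t`. -/
noncomputable def roughHom (t : WithTop ℝ) (s : ℝ) : ℕ →*₀ ℝ where
  toFun := (roughSet t).indicator fun n : ℕ => (n : ℝ) ^ (-s)
  map_zero' := Set.indicator_of_notMem (fun h => h.1 rfl) _
  map_one' := by
    rw [Set.indicator_of_mem]
    · simp
    · exact ⟨one_ne_zero, fun p hp hd => absurd (Nat.dvd_one.1 hd) hp.ne_one⟩
  map_mul' a b := by
    by_cases ha : a ∈ roughSet t <;> by_cases hb : b ∈ roughSet t <;>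
      simp [Set.indicator, mul_mem_roughSet, ha, hb,
        Real.mul_rpow (Nat.cast_nonneg a) (Nat.cast_nonneg b)]

theorem tsum_roughSet (t : WithTop ℝ) {s : ℝ} (hs : 1 < s) :
    ∑' r : roughSet t, (r : ℝ) ^ (-s) = (∑' n : ℕ, (n : ℝ) ^ (-s)) * sieveDensity t s := by
  have hs0 : s ≠ 0 := by linarith
  have hrough := EulerProduct.eulerProduct_completely_multiplicative (f := roughHom t s)
    ((summable_rpow_neg hs).indicator (roughSet t)).norm
  have hfull := EulerProduct.eulerProduct_completely_multiplicative (f := rpowNegHom s hs0)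
    (summable_rpow_neg hs).norm
  have hdens := (hasProd_sieveDensity t hs.le).tendsto_prod_nat
  have hlim := hfull.mul hdens
  rw [tsum_subtype (roughSet t) fun n : ℕ => (n : ℝ) ^ (-s)]
  refine tendsto_nhds_unique (hrough.congr fun N => ?_) hlim
  have hrange : ∏ p ∈ Finset.range N, eulerFactor t s p =
      ∏ p ∈ Nat.primesBelow N, eulerFactor t s p := by
    rw [Nat.primesBelow, Finset.prod_filter]
    refine Finset.prod_congr rfl fun p _ => ?_
    split_ifs with hp
    · rfl
    · exact if_neg fun h => hp h.1
  rw [hrange, ← Finset.prod_mul_distrib]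
  refine Finset.prod_congr rfl fun p hp => ?_
  have hpp := Nat.prime_of_mem_primesBelow hp
  change (1 - (roughSet t).indicator (fun n : ℕ => (n : ℝ) ^ (-s)) p)⁻¹ =
    (1 - (p : ℝ) ^ (-s))⁻¹ * eulerFactor t s p
  by_cases hpt : ((p : ℝ) : WithTop ℝ) ≤ t
  · rw [Set.indicator_of_notMem fun h => ((prime_mem_roughSet hpp).1 h).not_ge hpt,
      eulerFactor, if_pos ⟨hpp, hpt⟩, inv_mul_cancel₀]
    · simp
    · linarith [rpow_neg_le_half hpp hs.le]
  · rw [Set.indicator_of_mem ((prime_mem_roughSet hpp).2 (not_le.1 hpt)),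
      eulerFactor, if_neg fun h => hpt h.2, mul_one]

/-- The term `n ^ (-s) * ∏_{p ≤ θ n} (1 - p ^ (-s))`. -/
noncomputable def weight (θ : ℕ → WithTop ℝ) (s : ℝ) (n : ℕ) : ℝ :=
  (n : ℝ) ^ (-s) * sieveDensity (θ n) s

theorem weight_nonneg (θ : ℕ → WithTop ℝ) {s : ℝ} (hs : 1 ≤ s) (n : ℕ) : 0 ≤ weight θ s n :=
  mul_nonneg (Real.rpow_nonneg (Nat.cast_nonneg n) _) (sieveDensity_nonneg _ hs)

theorem tsum_rpow_neg_pos {s : ℝ} (hs : 1 < s) : 0 < ∑' n : ℕ, (n : ℝ) ^ (-s) :=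
  (summable_rpow_neg hs).tsum_pos (fun n => Real.rpow_nonneg (Nat.cast_nonneg n) _) 1 (by simp)

theorem hasSum_weight_of_core {θ : ℕ → WithTop ℝ} (hθ : DominatesPrimes θ) {E : Set ℕ}
    (hE : ∀ n ∈ E, BMem θ n) {s : ℝ} (hs : 1 < s) :
    HasSum (E.indicator fun n => (∑' m : ℕ, (m : ℝ) ^ (-s)) * weight θ s n)
      (∑' m, (core θ ⁻¹' E).indicator (fun m : ℕ => (m : ℝ) ^ (-s)) m) := by
  have hsum := (summable_rpow_neg hs).indicator (core θ ⁻¹' E)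
  refine HasSum.sigma ((Equiv.sigmaFiberEquiv (core θ)).hasSum_iff.2 hsum.hasSum) fun n => ?_
  have hfib : Summable fun c : {m // core θ m = n} =>
      (core θ ⁻¹' E).indicator (fun m : ℕ => (m : ℝ) ^ (-s)) c :=
    hsum.subtype {m | core θ m = n}
  change HasSum (fun c : {m // core θ m = n} =>
      (core θ ⁻¹' E).indicator (fun m : ℕ => (m : ℝ) ^ (-s)) c) _
  convert hfib.hasSum using 1
  by_cases hn : n ∈ E
  · rw [Set.indicator_of_mem hn]
    have h1 : ∑' c : {m // core θ m = n},
        (core θ ⁻¹' E).indicator (fun m : ℕ => (m : ℝ) ^ (-s)) c =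
        ∑' c : ↑(core θ ⁻¹' {n}), (c : ℝ) ^ (-s) :=
      tsum_congr fun c => Set.indicator_of_mem (Set.mem_preimage.2 (by rwa [c.2])) _
    have hn0 : n ≠ 0 := (hE n hn).1.ne'
    rw [h1, preimage_core hθ (hE n hn),
      tsum_image (fun m : ℕ => (m : ℝ) ^ (-s)) (mul_right_injective₀ hn0).injOn]
    simp only [Nat.cast_mul, Real.mul_rpow (Nat.cast_nonneg _) (Nat.cast_nonneg _)]
    rw [tsum_mul_left, tsum_roughSet _ hs, weight]
    ring
  · rw [Set.indicator_of_notMem hn]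
    refine ((tsum_congr fun c => ?_).trans tsum_zero).symm
    exact Set.indicator_of_notMem (fun h => hn (c.2 ▸ Set.mem_preimage.1 h)) _

theorem summable_weight {θ : ℕ → WithTop ℝ} (hθ : DominatesPrimes θ) {E : Set ℕ}
    (hE : ∀ n ∈ E, BMem θ n) {s : ℝ} (hs : 1 < s) : Summable (E.indicator (weight θ s)) := by
  have h := (hasSum_weight_of_core hθ hE hs).summable
  rw [show (E.indicator fun n => (∑' m : ℕ, (m : ℝ) ^ (-s)) * weight θ s n) =
    fun n => (∑' m : ℕ, (m : ℝ) ^ (-s)) * E.indicator (weight θ s) n from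
    funext fun n => Set.indicator_const_mul E _ _ n] at h
  exact (summable_mul_left_iff (tsum_rpow_neg_pos hs).ne').1 h

theorem mul_tsum_weight {θ : ℕ → WithTop ℝ} (hθ : DominatesPrimes θ) {E : Set ℕ}
    (hE : ∀ n ∈ E, BMem θ n) {s : ℝ} (hs : 1 < s) :
    (∑' m : ℕ, (m : ℝ) ^ (-s)) * ∑' n, E.indicator (weight θ s) n =
      ∑' m, (core θ ⁻¹' E).indicator (fun m : ℕ => (m : ℝ) ^ (-s)) m := by
  rw [← (hasSum_weight_of_core hθ hE hs).tsum_eq, ← tsum_mul_left]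
  exact tsum_congr fun n => (Set.indicator_const_mul E _ _ n).symm

theorem tsum_weight_le_one {θ : ℕ → WithTop ℝ} (hθ : DominatesPrimes θ) {E : Set ℕ}
    (hE : ∀ n ∈ E, BMem θ n) {s : ℝ} (hs : 1 < s) : ∑' n, E.indicator (weight θ s) n ≤ 1 := by
  refine le_of_mul_le_mul_left ?_ (tsum_rpow_neg_pos hs)
  rw [mul_tsum_weight hθ hE hs, mul_one]
  exact ((summable_rpow_neg hs).indicator _).tsum_le_tsum
    (fun m => Set.indicator_le_self' (fun m _ => Real.rpow_nonneg (Nat.cast_nonneg m) _) m)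
    (summable_rpow_neg hs)

theorem tendsto_rpow_neg_one {n : ℕ} (hn : n ≠ 0) :
    Tendsto (fun s : ℝ => (n : ℝ) ^ (-s)) (𝓝[>] 1) (𝓝 ((n : ℝ) ^ (-(1 : ℝ)))) :=
  tendsto_nhdsWithin_of_tendsto_nhds
    ((Real.continuousAt_const_rpow (Nat.cast_ne_zero.2 hn)).comp continuousAt_neg)

theorem summable_weight_one {θ : ℕ → WithTop ℝ} (hθ : DominatesPrimes θ) {E : Set ℕ}
    (hE : ∀ n ∈ E, BMem θ n) : Summable (E.indicator (weight θ 1)) := by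
  refine summable_of_sum_le (c := 1)
    (fun n => Set.indicator_nonneg (fun n _ => weight_nonneg θ le_rfl n) n) fun u => ?_
  have hlim : Tendsto (fun s : ℝ => ∑ n ∈ u,
      E.indicator (fun n : ℕ => (n : ℝ) ^ (-s) * sieveDensity (θ n) 1) n) (𝓝[>] 1)
      (𝓝 (∑ n ∈ u, E.indicator (weight θ 1) n)) := by
    refine tendsto_finsetSum _ fun n _ => ?_
    by_cases hn : n ∈ E
    · simp only [Set.indicator_of_mem hn]
      exact (tendsto_rpow_neg_one (hE n hn).1.ne').mul_const _
    · simp only [Set.indicator_of_notMem hn]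
      exact tendsto_const_nhds
  refine le_of_tendsto hlim ?_
  filter_upwards [self_mem_nhdsWithin] with s (hs : 1 < s)
  calc _ ≤ ∑ n ∈ u, E.indicator (weight θ s) n := by
        refine Finset.sum_le_sum fun n _ => Set.indicator_le_indicator ?_
        exact mul_le_mul_of_nonneg_left (sieveDensity_mono _ le_rfl hs.le)
          (Real.rpow_nonneg (Nat.cast_nonneg n) _)
    _ ≤ ∑' n, E.indicator (weight θ s) n := (summable_weight hθ hE hs).sum_le_tsum _ fun n _ =>
        Set.indicator_nonneg (fun n _ => weight_nonneg θ hs.le n) n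
    _ ≤ 1 := tsum_weight_le_one hθ hE hs

/-! ### The limit `s → 1` -/

theorem tendsto_exp_one_div_sub_one :
    Tendsto (fun s : ℝ => Real.exp (1 / (s - 1))) (𝓝[>] 1) atTop := by
  refine Real.tendsto_exp_atTop.comp ?_
  simp only [one_div]
  refine tendsto_inv_nhdsGT_zero.comp ?_
  refine tendsto_nhdsWithin_iff.2 ⟨?_, ?_⟩
  · refine tendsto_nhdsWithin_of_tendsto_nhds ?_
    simpa using (continuous_id.sub continuous_const).tendsto (1 : ℝ) (f := fun s : ℝ => s - 1)
  · filter_upwards [self_mem_nhdsWithin] with s (hs : 1 < s)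
    exact sub_pos.2 hs

/-- The elements of `E` whose threshold is at most `exp (1 / (s - 1))`. -/
def nearPart (θ : ℕ → WithTop ℝ) (E : Set ℕ) (s : ℝ) : Set ℕ :=
  {n ∈ E | θ n ≤ ((Real.exp (1 / (s - 1)) : ℝ) : WithTop ℝ)}

theorem tendsto_tsum_nearPart {θ : ℕ → WithTop ℝ} (hθ : DominatesPrimes θ)
    (hθ1 : ∀ n, n ≠ 0 → ((1 : ℝ) : WithTop ℝ) ≤ θ n) {E : Set ℕ} (hE : ∀ n ∈ E, BMem θ n) :
    Tendsto (fun s => ∑' n, (nearPart θ E s).indicator (weight θ s) n) (𝓝[>] 1)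
      (𝓝 (∑' n, E.indicator (weight θ 1) n)) := by
  refine tendsto_tsum_of_dominated_convergence
    ((summable_weight_one hθ hE).mul_left (Real.exp (2 + 2 * Real.log 4))) (fun n => ?_) ?_
  · by_cases hn : n ∈ E
    · rw [Set.indicator_of_mem hn]
      rcases eq_or_ne (θ n) ⊤ with htop | hne
      · have h0 (s : ℝ) : (nearPart θ E s).indicator (weight θ s) n = 0 := by
          refine Set.indicator_of_notMem (fun h => ?_) _
          have hle : θ n ≤ ((Real.exp (1 / (s - 1)) : ℝ) : WithTop ℝ) := h.2
          rw [htop] at hle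
          exact (WithTop.coe_lt_top _).not_ge hle
        simp only [h0, weight, htop, sieveDensity_top, mul_zero]
        exact tendsto_const_nhds
      · obtain ⟨z, hz⟩ := WithTop.ne_top_iff_exists.1 hne
        have hz1 : 1 ≤ z := by
          have := hθ1 n (hE n hn).1.ne'
          rwa [← hz, WithTop.coe_le_coe] at this
        have hlim : Tendsto (fun s => weight θ s n) (𝓝[>] 1) (𝓝 (weight θ 1 n)) := by
          unfold weight
          rw [← hz]
          exact (tendsto_rpow_neg_one (hE n hn).1.ne').mul
            (tendsto_sieveDensity_coe (by linarith))
        refine hlim.congr' ?_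
        filter_upwards [tendsto_exp_one_div_sub_one.eventually_ge_atTop z] with s hs
        have hmem : n ∈ nearPart θ E s := ⟨hn, by rw [← hz]; exact WithTop.coe_le_coe.2 hs⟩
        exact (Set.indicator_of_mem hmem _).symm
    · have h0 (s : ℝ) : (nearPart θ E s).indicator (weight θ s) n = 0 :=
        Set.indicator_of_notMem (fun h => hn h.1) _
      simp only [h0, Set.indicator_of_notMem hn]
      exact tendsto_const_nhds
  · filter_upwards [Ioc_mem_nhdsGT (show (1 : ℝ) < 2 by norm_num)] with s hs n
    rw [Real.norm_of_nonneg (Set.indicator_nonneg (fun n _ => weight_nonneg θ hs.1.le n) n)]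
    by_cases hn : n ∈ nearPart θ E s
    · rw [Set.indicator_of_mem hn, Set.indicator_of_mem hn.1]
      obtain ⟨z, hz, hzs⟩ := WithTop.le_coe_iff.1 hn.2
      have hn0 := (hE n hn.1).1.ne'
      have hz1 : 1 ≤ z := by
        have := hθ1 n hn0
        rwa [hz, WithTop.coe_le_coe] at this
      have hn1 : (1 : ℝ) ≤ n := by exact_mod_cast (hE n hn.1).1
      unfold weight
      rw [hz, mul_left_comm]
      exact mul_le_mul
        (Real.rpow_le_rpow_of_exponent_le hn1 (by linarith [hs.1]))
        (sieveDensity_coe_le hz1 hs.1 hs.2 hzs)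
        (sieveDensity_nonneg _ hs.1.le) (by positivity)
    · rw [Set.indicator_of_notMem hn]
      exact mul_nonneg (Real.exp_pos _).le
        (Set.indicator_nonneg (fun n _ => weight_nonneg θ le_rfl n) n)

theorem tendsto_tsum_weight {θ : ℕ → WithTop ℝ} (hθ : DominatesPrimes θ)
    (hθ1 : ∀ n, n ≠ 0 → ((1 : ℝ) : WithTop ℝ) ≤ θ n)
    (hdens : Tendsto (fun s : ℝ => (s - 1) *
      ∑' n, {n | BMem θ n}.indicator (fun n : ℕ => (n : ℝ) ^ (-s)) n) (𝓝[>] 1) (𝓝 0))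
    {E : Set ℕ} (hE : ∀ n ∈ E, BMem θ n) :
    Tendsto (fun s => ∑' n, E.indicator (weight θ s) n) (𝓝[>] 1)
      (𝓝 (∑' n, E.indicator (weight θ 1) n)) := by
  have hfar : Tendsto (fun s => ∑' n, (E \ nearPart θ E s).indicator (weight θ s) n)
      (𝓝[>] 1) (𝓝 0) := by
    refine tendsto_of_tendsto_of_tendsto_of_le_of_le' tendsto_const_nhds
      (by simpa using hdens.const_mul (Real.exp 1)) ?_ ?_
    · filter_upwards [self_mem_nhdsWithin] with s (hs : 1 < s)
      exact tsum_nonneg fun n => Set.indicator_nonneg (fun n _ => weight_nonneg θ hs.le n) n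
    · filter_upwards [self_mem_nhdsWithin] with s (hs : 1 < s)
      rw [← mul_assoc, ← tsum_mul_left]
      refine (summable_weight hθ (fun n hn => hE n hn.1) hs).tsum_le_tsum (fun n => ?_)
        (((summable_rpow_neg hs).indicator _).mul_left _)
      have hpow : 0 ≤ (n : ℝ) ^ (-s) := Real.rpow_nonneg (Nat.cast_nonneg n) _
      by_cases hn : n ∈ E \ nearPart θ E s
      · rw [Set.indicator_of_mem hn, Set.indicator_of_mem (show n ∈ {n | BMem θ n} from hE n hn.1),
          weight, mul_comm]
        exact mul_le_mul_of_nonneg_right (sieveDensity_le_of_exp_le hs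
          (not_le.1 fun h => hn.2 ⟨hn.1, h⟩).le) hpow
      · rw [Set.indicator_of_notMem hn]
        exact mul_nonneg (mul_nonneg (Real.exp_pos 1).le (sub_pos.2 hs).le)
          (Set.indicator_nonneg (fun m _ => Real.rpow_nonneg (Nat.cast_nonneg m) _) n)
  have hadd := (tendsto_tsum_nearPart hθ hθ1 hE).add hfar
  rw [add_zero] at hadd
  refine hadd.congr' ?_
  filter_upwards [self_mem_nhdsWithin] with s (hs : 1 < s)
  rw [← (summable_weight hθ (fun n hn => hE n hn.1) hs).tsum_add
    (summable_weight hθ (fun n hn => hE n hn.1) hs)]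
  refine tsum_congr fun n => ?_
  have hsub : nearPart θ E s ⊆ E := fun n hn => hn.1
  by_cases h1 : n ∈ nearPart θ E s
  · simp [h1, hsub h1]
  · by_cases h2 : n ∈ E <;> simp [h1, h2]

theorem tendsto_sub_one_mul_tsum_bMem {θ : ℕ → WithTop ℝ}
    (hB : (fun x : ℝ => (Bcount θ x : ℝ)) =o[atTop] (fun x : ℝ => x)) :
    Tendsto (fun s : ℝ => (s - 1) *
      ∑' n, {n | BMem θ n}.indicator (fun n : ℕ => (n : ℝ) ^ (-s)) n) (𝓝[>] 1) (𝓝 0) := by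
  set f : ℕ → ℝ := {n | BMem θ n}.indicator 1 with hf
  have hcount (N : ℕ) : ∑ k ∈ Finset.Icc 1 N, f k = Bcount θ N := by
    have hset : {n : ℕ | BMem θ n ∧ (n : ℝ) ≤ N} =
        ((Finset.Icc 1 N).filter fun n => BMem θ n : Finset ℕ) := by
      ext n
      simp only [Set.mem_ofPred_eq, Finset.coe_filter, Finset.mem_Icc, Nat.cast_le]
      exact ⟨fun h => ⟨⟨h.1.1, h.2⟩, h.1⟩, fun h => ⟨h.2, h.1.2⟩⟩
    rw [Bcount, hset, Nat.card_coe_set_eq, Set.ncard_coe_finset, Finset.card_filter]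
    push_cast
    exact Finset.sum_congr rfl fun n _ => by simp [hf, Set.indicator]
  have hlim : Tendsto (fun N : ℕ => (∑ k ∈ Finset.Icc 1 N, f k) / (N : ℝ)) atTop (𝓝 0) := by
    simp only [hcount]
    exact hB.tendsto_div_nhds_zero.comp tendsto_natCast_atTop_atTop
  have hL := LSeries_tendsto_sub_mul_nhds_one_of_tendsto_sum_div_and_nonneg f hlim
    fun n => Set.indicator_nonneg (fun _ _ => zero_le_one) n
  rw [← tendsto_ofReal_iff]
  refine hL.congr' ?_
  filter_upwards [self_mem_nhdsWithin] with s (hs : 1 < s)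
  push_cast
  congr 1
  rw [LSeries]
  refine tsum_congr fun n => ?_
  rcases eq_or_ne n 0 with rfl | hn
  · have : ¬ BMem θ 0 := fun h => h.1.ne' rfl
    simp [this]
  · rw [LSeries.term_of_ne_zero hn]
    by_cases h : BMem θ n
    · simp [hf, h, Complex.ofReal_cpow (Nat.cast_nonneg n), Complex.cpow_neg]
    · simp [hf, h]

/-! ### Exact powers of a prime -/

theorem tsum_indicator_pow_dvd {S : Set ℕ} {q : ℕ} (hq : q ≠ 0)
    (hS : ∀ m, q * m ∈ S ↔ m ∈ S) (s : ℝ) (k : ℕ) :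
    ∑' m, (S ∩ {m | q ^ k ∣ m}).indicator (fun m : ℕ => (m : ℝ) ^ (-s)) m =
      ((q : ℝ) ^ k) ^ (-s) * ∑' m, S.indicator (fun m : ℕ => (m : ℝ) ^ (-s)) m := by
  have hSk (m : ℕ) : q ^ k * m ∈ S ↔ m ∈ S := by
    induction k with
    | zero => simp
    | succ k ih => rw [pow_succ', mul_assoc, hS, ih]
  have himg : S ∩ {m | q ^ k ∣ m} = (q ^ k * ·) '' S := by
    ext m
    constructor
    · rintro ⟨hm, r, rfl⟩
      exact ⟨r, (hSk r).1 hm, rfl⟩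
    · rintro ⟨r, hr, rfl⟩
      exact ⟨(hSk r).2 hr, dvd_mul_right _ _⟩
  rw [← tsum_subtype, ← tsum_subtype, himg, tsum_image (fun m : ℕ => (m : ℝ) ^ (-s))
    (mul_right_injective₀ (pow_ne_zero k hq)).injOn, ← tsum_mul_left]
  refine tsum_congr fun m => ?_
  push_cast
  exact Real.mul_rpow (by positivity) (Nat.cast_nonneg _)

theorem tsum_indicator_exactPow {S : Set ℕ} {q : ℕ} (hq : q ≠ 0)
    (hS : ∀ m, q * m ∈ S ↔ m ∈ S) {s : ℝ} (hs : 1 < s) (h : ℕ) :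
    ∑' m, (S ∩ {m | q ^ h ∣ m ∧ ¬ q ^ (h + 1) ∣ m}).indicator (fun m : ℕ => (m : ℝ) ^ (-s)) m =
      (((q : ℝ) ^ h) ^ (-s) - ((q : ℝ) ^ (h + 1)) ^ (-s)) *
        ∑' m, S.indicator (fun m : ℕ => (m : ℝ) ^ (-s)) m := by
  rw [sub_mul, ← tsum_indicator_pow_dvd hq hS, ← tsum_indicator_pow_dvd hq hS,
    ← ((summable_rpow_neg hs).indicator _).tsum_sub ((summable_rpow_neg hs).indicator _)]
  refine tsum_congr fun m => ?_
  have hdvd : q ^ (h + 1) ∣ m → q ^ h ∣ m := (pow_dvd_pow q h.le_succ).trans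
  by_cases h1 : m ∈ S <;> by_cases h2 : q ^ (h + 1) ∣ m <;> by_cases h3 : q ^ h ∣ m <;>
    simp_all [Set.indicator]

theorem tsum_weight_exactPow {θ : ℕ → WithTop ℝ} (hθ : DominatesPrimes θ) {q h : ℕ}
    (hq : q.Prime) (hh : 0 < h) {s : ℝ} (hs : 1 < s) :
    ∑' n, {n | BMem θ n ∧ q ^ h ∣ n ∧ ¬ q ^ (h + 1) ∣ n}.indicator (weight θ s) n =
      (((q : ℝ) ^ h) ^ (-s) - ((q : ℝ) ^ (h + 1)) ^ (-s)) *
        ∑' n, {n | BMem θ n ∧ ((q : ℝ) : WithTop ℝ) ≤ θ n}.indicator (weight θ s) n := by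
  set S : Set ℕ := {m | m ≠ 0 ∧ ReachesBound θ q m} with hS
  have hSq (m : ℕ) : q * m ∈ S ↔ m ∈ S := by
    simp only [hS, Set.mem_ofPred_eq, mul_ne_zero_iff, and_iff_right hq.ne_zero]
    exact and_congr_right fun hm => reachesBound_prime_mul_iff hq hm
  have hcore (m : ℕ) : m ≠ 0 ↔ BMem θ (core θ m) := by
    refine ⟨fun hm => (core_spec θ hm).1, fun hm h0 => ?_⟩
    rw [h0, core, dif_neg (not_not.2 rfl)] at hm
    exact hm.1.ne' rfl
  have h1 : core θ ⁻¹' {n | BMem θ n ∧ ((q : ℝ) : WithTop ℝ) ≤ θ n} = S := by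
    ext m
    simp only [Set.mem_preimage, Set.mem_ofPred_eq, hS, ← hcore]
    exact and_congr_right fun hm => le_core_iff hθ hm
  have h2 : core θ ⁻¹' {n | BMem θ n ∧ q ^ h ∣ n ∧ ¬ q ^ (h + 1) ∣ n} =
      S ∩ {m | q ^ h ∣ m ∧ ¬ q ^ (h + 1) ∣ m} := by
    ext m
    simp only [Set.mem_preimage, Set.mem_ofPred_eq, hS, ← hcore, Set.mem_inter_iff, and_assoc]
    exact and_congr_right fun hm => exactPow_core_iff hθ hq hh hm
  refine mul_left_cancel₀ (tsum_rpow_neg_pos hs).ne' ?_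
  rw [mul_left_comm, mul_tsum_weight hθ (fun n hn => hn.1) hs,
    mul_tsum_weight hθ (fun n hn => hn.1) hs, h1, h2, tsum_indicator_exactPow hq.ne_zero hSq hs]

theorem weight_one (θ : ℕ → WithTop ℝ) (n : ℕ) :
    weight θ 1 n = (1 / (n : ℝ)) *
      ∏' p : ℕ, (if p.Prime ∧ ((p : ℝ) : WithTop ℝ) ≤ θ n then 1 - 1 / (p : ℝ) else 1) := by
  simp only [weight, sieveDensity, eulerFactor, Real.rpow_neg_one, one_div]

end SieveDecomposition

theorem lemma2_s_eq_one (θ : ℕ → WithTop ℝ)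
    (hθ1 : (2 : WithTop ℝ) ≤ θ 1)
    (hθ2 : ∀ n : ℕ, 2 ≤ n → ∀ p ∈ n.primeFactors, ((p : ℝ) : WithTop ℝ) ≤ θ n)
    (hB : (fun x : ℝ => (Bcount θ x : ℝ)) =o[Filter.atTop] (fun x : ℝ => x))
    (q : ℕ) (hq : q.Prime) (h : ℕ) (hh : 0 < h) :
    (∑' n : ℕ,
      if BMem θ n ∧ q ^ h ∣ n ∧ ¬ q ^ (h + 1) ∣ n then
        (1 / (n : ℝ)) *
          ∏' p : ℕ, (if p.Prime ∧ ((p : ℝ) : WithTop ℝ) ≤ θ n then 1 - 1 / (p : ℝ) else 1)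
      else 0)
    = (1 - 1 / (q : ℝ)) / (q : ℝ) ^ h *
      ∑' n : ℕ,
        if BMem θ n ∧ ((q : ℝ) : WithTop ℝ) ≤ θ n then
          (1 / (n : ℝ)) *
            ∏' p : ℕ, (if p.Prime ∧ ((p : ℝ) : WithTop ℝ) ≤ θ n then 1 - 1 / (p : ℝ) else 1)
        else 0 := by
  have hθ : SieveDecomposition.DominatesPrimes θ := fun n p hn hp hd =>
    hθ2 n (hp.two_le.trans (Nat.le_of_dvd (Nat.pos_of_ne_zero hn) hd)) p
      (Nat.mem_primeFactors.2 ⟨hp, hd, hn⟩)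
  have hone (n : ℕ) (hn : n ≠ 0) : ((1 : ℝ) : WithTop ℝ) ≤ θ n := by
    rcases eq_or_ne n 1 with rfl | hn1
    · exact le_trans (WithTop.coe_le_coe.2 one_le_two) hθ1
    · obtain ⟨p, hp, hd⟩ := Nat.exists_prime_and_dvd hn1
      exact le_trans (WithTop.coe_le_coe.2 (by exact_mod_cast hp.one_lt.le)) (hθ n p hn hp hd)
  have hdens := SieveDecomposition.tendsto_sub_one_mul_tsum_bMem hB
  have hA := SieveDecomposition.tendsto_tsum_weight hθ hone hdens
    (E := {n | BMem θ n ∧ q ^ h ∣ n ∧ ¬ q ^ (h + 1) ∣ n}) fun n hn => hn.1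
  have hQ := SieveDecomposition.tendsto_tsum_weight hθ hone hdens
    (E := {n | BMem θ n ∧ ((q : ℝ) : WithTop ℝ) ≤ θ n}) fun n hn => hn.1
  have hpow (k : ℕ) := SieveDecomposition.tendsto_rpow_neg_one (pow_ne_zero k hq.ne_zero)
  have hlim := ((hpow h).sub (hpow (h + 1))).mul hQ
  have heq := tendsto_nhds_unique (hA.congr' (by
    filter_upwards [self_mem_nhdsWithin] with s hs
    rw [SieveDecomposition.tsum_weight_exactPow hθ hq hh hs, Nat.cast_pow, Nat.cast_pow])) hlim
  have hconst : ((q ^ h : ℕ) : ℝ) ^ (-(1 : ℝ)) - ((q ^ (h + 1) : ℕ) : ℝ) ^ (-(1 : ℝ)) =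
      (1 - 1 / (q : ℝ)) / (q : ℝ) ^ h := by
    have hq0 : (q : ℝ) ≠ 0 := Nat.cast_ne_zero.2 hq.ne_zero
    rw [Real.rpow_neg_one, Real.rpow_neg_one]
    push_cast
    field_simp
    ring
  rw [hconst] at heq
  simpa only [Set.indicator, Set.mem_ofPred_eq, SieveDecomposition.weight_one] using heq
end
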